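/- (Lemma 1) For every optimal conditional machine U there exists a constant c ∈ ℕ such that for all strings a, b, letting n = C(a) + C(b), there exist strings a' and b' with: |a'| = C(a) and |b'| = C(b); C(a') ≥ C(a) − c·log n and C(b') ≥ C(b) − c·log n; C(a'|a) ≤ c·log n and C(b'|b) ≤ c·log n; and for every l with 1 ≤ l ≤ |a'| and every m with 1 ≤ m ≤ |b'|, |I(a'_l : b'_m) − max(0, l + m − C(a,b))| ≤ c·log n, where a'_l and b'_m denote the prefixes of a' and b' of lengths l and m respectively (differences in ℤ). -/

import Mathlib

/-- A string is a finite binary string. -/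
abbrev Str : Type := List Bool

/-- A conditional machine: a partial computable function mapping a pair of
strings `(p, y)` to a string. -/
abbrev CondMachine : Type := {V : Str × Str →. Str // Partrec V}

/-- `condC V x y` is `C_V(x|y)`: the least length of a program `p` with
`V (p, y) = x`, as an element of `ℕ∞` (it is `⊤` if no such `p` exists). -/
noncomputable def condC (V : CondMachine) (x y : Str) : ℕ∞ :=
  sInf {n : ℕ∞ | ∃ p : Str, x ∈ V.1 (p, y) ∧ (p.length : ℕ∞) = n}

/-- A conditional machine `U` is optimal if for every conditional machine `V`
there is a constant `d` with `C_U(x|y) ≤ C_V(x|y) + d` for all `x, y`. -/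
def OptimalMachine (U : CondMachine) : Prop :=
  ∀ V : CondMachine, ∃ d : ℕ, ∀ x y : Str, condC U x y ≤ condC V x y + (d : ℕ∞)

/-- For an optimal machine all complexities are finite natural numbers. -/
noncomputable def KC (U : CondMachine) (x y : Str) : ℕ := (condC U x y).toNat

/-- `log2 n = Nat.log 2 (n + 2)`, so `log2 n ≥ 1`. -/
def log2 (n : ℕ) : ℕ := Nat.log 2 (n + 2)

/-- `SigmaOne p` says that `p` is recursively enumerable, in the normal form
`∃ t, R a t` with `R` primitive recursive. -/
def SigmaOne {α : Type} [Primcodable α] (p : α → Prop) : Prop :=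
  ∃ R : α → ℕ → Prop, PrimrecRel R ∧ ∀ a, p a ↔ ∃ t, R a t

section SigmaOne

variable {α β : Type} [Primcodable α] [Primcodable β]

theorem PrimrecPred.sigmaOne {p : α → Prop} (hp : PrimrecPred p) : SigmaOne p :=
  ⟨fun a _ => p a, hp.comp Primrec.fst, fun _ => by simp⟩

theorem SigmaOne.comp {p : β → Prop} {f : α → β} (hp : SigmaOne p) (hf : Primrec f) :
    SigmaOne fun a => p (f a) := by
  obtain ⟨R, hR, h⟩ := hp
  exact ⟨fun a t => R (f a) t, hR.comp (hf.comp Primrec.fst) Primrec.snd, fun a => h (f a)⟩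

theorem SigmaOne.and {p q : α → Prop} (hp : SigmaOne p) (hq : SigmaOne q) :
    SigmaOne fun a => p a ∧ q a := by
  obtain ⟨R, hR, hR'⟩ := hp
  obtain ⟨S, hS, hS'⟩ := hq
  refine ⟨fun a t => R a t.unpair.1 ∧ S a t.unpair.2, ?_, fun a => ?_⟩
  · have hu : Primrec fun x : α × ℕ => x.2.unpair := Primrec.unpair.comp Primrec.snd
    exact PrimrecPred.and (hR.comp Primrec.fst (Primrec.fst.comp hu))
      (hS.comp Primrec.fst (Primrec.snd.comp hu))
  · simp only [hR', hS']
    constructor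
    · rintro ⟨⟨s, hs⟩, t, ht⟩
      exact ⟨Nat.pair s t, by simpa using ⟨hs, ht⟩⟩
    · rintro ⟨t, hs, ht⟩
      exact ⟨⟨_, hs⟩, _, ht⟩

/-- A recursively enumerable relation is listed, for each parameter, by a primitive recursive
function. -/
theorem SigmaOne.exists_enum {p : α × β → Prop} (hp : SigmaOne p) :
    ∃ f : α → ℕ → Option β, Primrec₂ f ∧ ∀ a b, p (a, b) ↔ ∃ t, f a t = some b := by
  classical
  obtain ⟨R, hR, h⟩ := hp
  refine ⟨fun a t => (Encodable.decode (α := β) t.unpair.1).bind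
    fun b => if R (a, b) t.unpair.2 then some b else none, ?_, fun a b => ?_⟩
  · refine Primrec.option_bind
      (Primrec.decode.comp (Primrec.fst.comp (Primrec.unpair.comp Primrec.snd))) ?_
    refine Primrec.ite ?_ (Primrec.option_some.comp Primrec.snd) (Primrec.const none)
    exact hR.comp (Primrec.pair (Primrec.fst.comp Primrec.fst) Primrec.snd)
      (Primrec.snd.comp (Primrec.unpair.comp (Primrec.snd.comp Primrec.fst)))
  · rw [h]
    constructor
    · rintro ⟨t, ht⟩
      exact ⟨Nat.pair (Encodable.encode b) t, by simp [ht]⟩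
    · rintro ⟨t, ht⟩
      obtain ⟨b', -, hb'⟩ := Option.bind_eq_some_iff.1 ht
      split_ifs at hb' with hR'
      obtain rfl : b' = b := by simpa using hb'
      exact ⟨_, hR'⟩

theorem SigmaOne.exists {p : α × β → Prop} (hp : SigmaOne p) :
    SigmaOne fun a => ∃ b, p (a, b) := by
  obtain ⟨f, hf, h⟩ := hp.exists_enum
  refine ⟨fun a t => (f a t).isSome = true, ?_, fun a => ?_⟩
  · exact Primrec.eq.comp (Primrec.option_isSome.comp hf) (Primrec.const true)
  · simp only [h, Option.isSome_iff_exists]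
    exact exists_comm

theorem SigmaOne.forall_mem_list {p : β × α → Prop} (hp : SigmaOne p) :
    SigmaOne fun x : List β × α => ∀ b ∈ x.1, p (b, x.2) := by
  obtain ⟨R, hR, h⟩ := hp
  have hlt : PrimrecRel fun (n : ℕ) (y : β × α) => ∃ t < n, R y t :=
    ((PrimrecRel.exists_mem_list (R := fun t y => R y t) hR.swap).comp
      (Primrec.list_range.comp Primrec.fst) Primrec.snd).of_eq fun _ => by simp
  have hlist : PrimrecRel fun (L : List β) (y : α × ℕ) => ∀ b ∈ L, ∃ t < y.2, R (b, y.1) t :=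
    PrimrecRel.forall_mem_list (R := fun b (y : α × ℕ) => ∃ t < y.2, R (b, y.1) t)
      (hlt.comp (Primrec.snd.comp Primrec.snd)
        (Primrec.pair Primrec.fst (Primrec.fst.comp Primrec.snd)))
  refine ⟨fun x n => ∀ b ∈ x.1, ∃ t < n, R (b, x.2) t, ?_, fun x => ?_⟩
  · exact hlist.comp (Primrec.fst.comp Primrec.fst)
      (Primrec.pair (Primrec.snd.comp Primrec.fst) Primrec.snd)
  · simp only [h]
    constructor
    · intro H
      choose! g hg using H
      refine ⟨(x.1.map g).sum + 1, fun b hb => ⟨g b, ?_, hg b hb⟩⟩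
      exact Nat.lt_succ_of_le (List.single_le_sum (by simp) _ (List.mem_map_of_mem hb))
    · rintro ⟨n, H⟩ b hb
      obtain ⟨t, -, ht⟩ := H b hb
      exact ⟨t, ht⟩

theorem Primrec.list_nodup : PrimrecPred (List.Nodup : List α → Prop) := by
  classical
  have hmem : PrimrecRel fun (L : List α) (a : α) => ∃ b ∈ L, b = a :=
    PrimrecRel.exists_mem_list Primrec.eq
  refine Primrec.primrecPred (p := (List.Nodup : List α → Prop)) ?_
  have hrec : Primrec fun L : List α => (List.rec true
      (fun a l ih => decide (¬ ∃ b ∈ l, b = a) && ih) L : Bool) := by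
    refine Primrec.list_rec (h := fun (_ : List α) (x : α × List α × Bool) =>
      decide (¬ ∃ b ∈ x.2.1, b = x.1) && x.2.2) Primrec.id (Primrec.const true) ?_
    refine Primrec.and.comp (PrimrecPred.decide (PrimrecPred.not (hmem.comp ?_ ?_))) ?_
    · exact Primrec.fst.comp (Primrec.snd.comp Primrec.snd)
    · exact Primrec.fst.comp Primrec.snd
    · exact Primrec.snd.comp (Primrec.snd.comp Primrec.snd)
  refine hrec.of_eq fun L => ?_
  induction L with
  | nil => simp
  | cons a l ih => simp only [ih]; simp

/-- The quantifier asserting at least a given number of witnesses preserves recursive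
enumerability. -/
theorem SigmaOne.many {p : β × α → Prop} (hp : SigmaOne p) :
    SigmaOne fun x : ℕ × α => ∃ L : List β, L.length = x.1 ∧ L.Nodup ∧ ∀ b ∈ L, p (b, x.2) := by
  refine SigmaOne.exists (p := fun y : (ℕ × α) × List β =>
    y.2.length = y.1.1 ∧ y.2.Nodup ∧ ∀ b ∈ y.2, p (b, y.1.2)) ?_
  refine SigmaOne.and (PrimrecPred.sigmaOne ?_) (SigmaOne.and (PrimrecPred.sigmaOne ?_) ?_)
  · exact Primrec.eq.comp (Primrec.list_length.comp Primrec.snd) (Primrec.fst.comp Primrec.fst)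
  · exact Primrec.list_nodup.comp Primrec.snd
  · exact hp.forall_mem_list.comp (Primrec.pair Primrec.snd (Primrec.snd.comp Primrec.fst))

theorem Partrec.sigmaOne {f : α →. β} (hf : Partrec f) :
    SigmaOne fun x : α × β => x.2 ∈ f x.1 := by
  obtain ⟨c, hc⟩ := Nat.Partrec.Code.exists_code.1 hf
  refine ⟨fun x t => c.evaln t (Encodable.encode x.1) = some (Encodable.encode x.2), ?_,
    fun x => ?_⟩
  · refine Primrec.eq.comp ?_ ?_
    · exact Nat.Partrec.Code.primrec_evaln.comp (Primrec.pair (Primrec.pair Primrec.snd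
        (Primrec.const c)) (Primrec.encode.comp (Primrec.fst.comp Primrec.fst)))
    · exact Primrec.option_some.comp (Primrec.encode.comp (Primrec.snd.comp Primrec.fst))
  · have : Encodable.encode x.2 ∈ c.eval (Encodable.encode x.1) ↔ x.2 ∈ f x.1 := by
      rw [hc]
      simp [Encodable.encode_injective.eq_iff]
    exact this.symm.trans Nat.Partrec.Code.evaln_complete

theorem Computable.sigmaOne {f : α → β} (hf : Computable f) :
    SigmaOne fun x : α × β => x.2 = f x.1 :=
  (Partrec.sigmaOne hf.partrec).comp Primrec.id |> fun h => by simpa using h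

/-- A recursively enumerable relation has a partial computable choice function. -/
theorem SigmaOne.exists_partrec {p : α × β → Prop} (hp : SigmaOne p) :
    ∃ f : α →. β, Partrec f ∧ (∀ a, ∀ b ∈ f a, p (a, b)) ∧ ∀ a b, p (a, b) → (f a).Dom := by
  obtain ⟨f, hf, h⟩ := hp.exists_enum
  refine ⟨fun a => Nat.rfindOpt (f a), Partrec.rfindOpt hf.to_comp, fun a b hb => ?_,
    fun a b hab => ?_⟩
  · exact (h a b).2 (Nat.rfindOpt_spec hb)
  · obtain ⟨t, ht⟩ := (h a b).1 hab
    exact Nat.rfindOpt_dom.2 ⟨t, b, ht⟩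

/-- Uniformization: a recursively enumerable relation contains a recursively enumerable
partial function with the same domain. -/
theorem SigmaOne.uniformize {p : α × β → Prop} (hp : SigmaOne p) :
    ∃ q : α × β → Prop, SigmaOne q ∧ (∀ x, q x → p x) ∧
      (∀ a b b', q (a, b) → q (a, b') → b = b') ∧ ∀ a b, p (a, b) → ∃ b', q (a, b') := by
  obtain ⟨f, hf, h₁, h₂⟩ := hp.exists_partrec
  refine ⟨fun x => x.2 ∈ f x.1, hf.sigmaOne, fun x hx => h₁ _ _ hx,
    fun a b b' => Part.mem_unique, fun a b hab => ?_⟩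
  exact ⟨(f a).get (h₂ a b hab), Part.get_mem _⟩

/-- The elements satisfying a recursively enumerable condition can be numbered, in the order of
their enumeration, by a recursively enumerable single-valued relation. -/
theorem SigmaOne.exists_numbering {p : α × β → Prop} (hp : SigmaOne p) :
    ∃ q : (α × ℕ) × β → Prop, SigmaOne q ∧
      (∀ a j b b', q ((a, j), b) → q ((a, j), b') → b = b') ∧
      ∀ (a : α) (G : Finset β), (∀ b, p (a, b) → b ∈ G) →
        ∀ b, p (a, b) → ∃ j < G.card, q ((a, j), b) := by
  classical
  obtain ⟨f, hf, h⟩ := hp.exists_enum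
  let new : α → ℕ → Prop := fun a t => (f a t).isSome = true ∧ ∀ s < t, f a s ≠ f a t
  have hnew : PrimrecRel new := by
    refine PrimrecPred.and ?_ ?_
    · exact Primrec.eq.comp (Primrec.option_isSome.comp hf) (Primrec.const true)
    · have : PrimrecRel fun (n : ℕ) (y : α × ℕ) => ∀ s < n, f y.1 s ≠ f y.1 y.2 :=
        ((PrimrecRel.forall_mem_list (R := fun s (y : α × ℕ) => f y.1 s ≠ f y.1 y.2)
          (PrimrecPred.not (Primrec.eq.comp
            (hf.comp (Primrec.fst.comp Primrec.snd) Primrec.fst)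
            (hf.comp (Primrec.fst.comp Primrec.snd) (Primrec.snd.comp Primrec.snd))))).comp
          (Primrec.list_range.comp Primrec.fst) Primrec.snd).of_eq fun _ => by simp
      exact this.comp Primrec.snd Primrec.id
  let cnt : α → ℕ → ℕ := fun a t => ((List.range t).filter fun s => new a s).length
  have hcnt : Primrec₂ cnt := by
    have : Primrec₂ fun (L : List ℕ) (a : α) => L.filter fun s => new a s :=
      PrimrecRel.listFilter (R := fun s a => new a s) hnew.swap
    exact Primrec.list_length.comp
      (this.comp (Primrec.list_range.comp Primrec.snd) Primrec.fst)
  have hcnt_card : ∀ a t, cnt a t = ((Finset.range t).filter fun s => new a s).card :=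
    fun a t => rfl
  have hcnt_lt : ∀ a s t, new a s → s < t → cnt a s < cnt a t := by
    intro a s t hs hst
    rw [hcnt_card, hcnt_card]
    refine Finset.card_lt_card (Finset.ssubset_iff_of_subset ?_ |>.2 ⟨s, ?_, ?_⟩)
    · intro u hu
      simp only [Finset.mem_filter, Finset.mem_range] at hu ⊢
      exact ⟨hu.1.trans hst, hu.2⟩
    · simp [hst, hs]
    · simp
  refine ⟨fun x => ∃ t, new x.1.1 t ∧ cnt x.1.1 t = x.1.2 ∧ f x.1.1 t = some x.2,
    ?_, ?_, ?_⟩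
  · refine SigmaOne.exists (p := fun y : ((α × ℕ) × β) × ℕ =>
      new y.1.1.1 y.2 ∧ cnt y.1.1.1 y.2 = y.1.1.2 ∧ f y.1.1.1 y.2 = some y.1.2)
      (PrimrecPred.sigmaOne ?_)
    have ha : Primrec fun y : ((α × ℕ) × β) × ℕ => y.1.1.1 :=
      Primrec.fst.comp (Primrec.fst.comp Primrec.fst)
    refine PrimrecPred.and (hnew.comp ha Primrec.snd) (PrimrecPred.and ?_ ?_)
    · exact Primrec.eq.comp (hcnt.comp ha Primrec.snd)
        (Primrec.snd.comp (Primrec.fst.comp Primrec.fst))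
    · exact Primrec.eq.comp (hf.comp ha Primrec.snd)
        (Primrec.option_some.comp (Primrec.snd.comp Primrec.fst))
  · rintro a j b b' ⟨s, hs, hsj, hsb⟩ ⟨t, ht, htj, htb⟩
    have hst : s = t := by
      rcases lt_trichotomy s t with hlt | rfl | hlt
      · have := hcnt_lt a s t hs hlt
        simp only at hsj htj
        omega
      · rfl
      · have := hcnt_lt a t s ht hlt
        simp only at hsj htj
        omega
    subst hst
    simpa using hsb.symm.trans htb
  · intro a G hG b hb
    have hex : ∃ t, f a t = some b := (h a b).1 hb
    have hfind := Nat.find_spec hex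
    have hnew_t : new a (Nat.find hex) := by
      refine ⟨by simp [hfind], fun s hs heq => Nat.find_min hex hs (heq.trans hfind)⟩
    refine ⟨cnt a (Nat.find hex), ?_, Nat.find hex, hnew_t, rfl, hfind⟩
    refine (hcnt_lt a _ (Nat.find hex + 1) hnew_t (Nat.lt_succ_self _)).trans_le ?_
    rw [hcnt_card]
    refine Finset.card_le_card_of_injOn (fun t => (f a t).getD b) ?_ ?_
    · intro t ht
      simp only [Finset.coe_filter, Set.mem_ofPred_eq] at ht
      obtain ⟨b', hb'⟩ := Option.isSome_iff_exists.1 ht.2.1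
      simpa [hb'] using hG b' ((h a b').2 ⟨t, hb'⟩)
    · intro s hs t ht hst
      simp only [Finset.coe_filter, Set.mem_ofPred_eq] at hs ht
      obtain ⟨b₁, hb₁⟩ := Option.isSome_iff_exists.1 hs.2.1
      obtain ⟨b₂, hb₂⟩ := Option.isSome_iff_exists.1 ht.2.1
      simp only [hb₁, hb₂, Option.getD_some] at hst
      rcases lt_trichotomy s t with hlt | rfl | hlt
      · exact absurd (by rw [hb₁, hb₂, hst]) (ht.2.2 s hlt)
      · rfl
      · exact absurd (by rw [hb₁, hb₂, hst]) (hs.2.2 t hlt)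

end SigmaOne

theorem card_many_hits_mul_two_pow_le {Y : Type} [Fintype Y] [DecidableEq Y] (D r : ℕ)
    (S : Finset Y) (hS : S.card * (2 * D) ≤ Fintype.card Y) :
    (Finset.univ.filter fun z : Fin D → Y =>
      r ≤ (Finset.univ.filter fun i => z i ∈ S).card).card * 2 ^ r ≤ Fintype.card Y ^ D := by
  classical
  rcases lt_or_ge D r with hDr | hrD
  · rw [Finset.filter_false_of_mem]
    · simp
    · intro z _
      have := Finset.card_filter_le (Finset.univ : Finset (Fin D)) (fun i => z i ∈ S)
      simp only [Finset.card_univ, Fintype.card_fin] at this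
      omega
  have hsub : (Finset.univ.filter fun z : Fin D → Y =>
      r ≤ (Finset.univ.filter fun i => z i ∈ S).card) ⊆
      (Finset.powersetCard r (Finset.univ : Finset (Fin D))).biUnion fun I =>
        Fintype.piFinset fun i => if i ∈ I then S else Finset.univ := by
    intro z hz
    obtain ⟨I, hI, hIr⟩ := Finset.exists_subset_card_eq (Finset.mem_filter.1 hz).2
    refine Finset.mem_biUnion.2 ⟨I, Finset.mem_powersetCard.2 ⟨Finset.subset_univ _, hIr⟩, ?_⟩
    refine Fintype.mem_piFinset.2 fun i => ?_
    split_ifs with hi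
    · exact (Finset.mem_filter.1 (hI hi)).2
    · exact Finset.mem_univ _
  have hpi : ∀ I ∈ Finset.powersetCard r (Finset.univ : Finset (Fin D)),
      (Fintype.piFinset fun i => if i ∈ I then S else Finset.univ).card ≤
        S.card ^ r * Fintype.card Y ^ (D - r) := by
    intro I hI
    have hIr := (Finset.mem_powersetCard.1 hI).2
    rw [Fintype.card_piFinset]
    simp only [apply_ite Finset.card, Finset.prod_ite, Finset.prod_const, Finset.card_univ]
    have h₁ : (Finset.univ.filter fun i => i ∈ I).card = r := by simp [hIr]
    have h₂ : (Finset.univ.filter fun i => i ∉ I).card = D - r := by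
      have := Finset.card_filter_add_card_filter_not (s := (Finset.univ : Finset (Fin D)))
        (fun i => i ∈ I)
      simp only [Finset.card_univ, Fintype.card_fin] at this
      omega
    rw [h₁, h₂]
  have hchoose : D.choose r ≤ D ^ r := Nat.choose_le_pow D r
  calc _ ≤ (D.choose r * (S.card ^ r * Fintype.card Y ^ (D - r))) * 2 ^ r := by
        refine Nat.mul_le_mul_right _ ((Finset.card_le_card hsub).trans ?_)
        refine (Finset.card_biUnion_le_card_mul _ _ _ hpi).trans ?_
        simp
    _ ≤ (D ^ r * (S.card ^ r * Fintype.card Y ^ (D - r))) * 2 ^ r := by gcongr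
    _ = (S.card * (2 * D)) ^ r * Fintype.card Y ^ (D - r) := by ring
    _ ≤ Fintype.card Y ^ r * Fintype.card Y ^ (D - r) := by gcongr
    _ = Fintype.card Y ^ D := by rw [← pow_add, Nat.add_sub_cancel' hrD]

/-- Probabilistic existence of a family of `D` hash functions such that few points are sent
into a small set `S` by at least `r` of them, simultaneously for all `S` in a given family. -/
theorem exists_hash_of_family {X Y : Type} [Fintype X] [Fintype Y] [DecidableEq X]
    [DecidableEq Y] [Nonempty Y] (k D r : ℕ) (hX : Fintype.card X = 2 ^ k) (hr : 4 * k < r)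
    (fam : ℕ → Finset (Finset Y)) (hfam : ∀ t, 1 ≤ t → (fam t).card ≤ 2 ^ (2 * k * t))
    (hcard : ∀ t, ∀ S ∈ fam t, S.card * (2 * D) ≤ Fintype.card Y) :
    ∃ F : X → Fin D → Y, ∀ t, 1 ≤ t → ∀ S ∈ fam t, ∀ T : Finset X, T.card = t →
      ∃ x ∈ T, (Finset.univ.filter fun i => F x i ∈ S).card < r := by
  classical
  let B : Finset Y → Finset (Fin D → Y) := fun S => Finset.univ.filter fun z =>
    r ≤ (Finset.univ.filter fun i => z i ∈ S).card
  let bad : ℕ → Finset (X → Fin D → Y) := fun t => (fam t).biUnion fun S =>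
    (Finset.powersetCard t (Finset.univ : Finset X)).biUnion fun T =>
      Fintype.piFinset fun x => if x ∈ T then B S else Finset.univ
  have hΩ : 0 < Fintype.card (X → Fin D → Y) := Fintype.card_pos
  have hpi : ∀ t, ∀ S ∈ fam t, ∀ T ∈ Finset.powersetCard t (Finset.univ : Finset X),
      (Fintype.piFinset fun x => if x ∈ T then B S else Finset.univ).card * 2 ^ (r * t) ≤
        Fintype.card (X → Fin D → Y) := by
    intro t S hS T hT
    have hTt := (Finset.mem_powersetCard.1 hT).2
    have hB : (B S).card * 2 ^ r ≤ Fintype.card (Fin D → Y) := by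
      simpa using card_many_hits_mul_two_pow_le D r S (hcard t S hS)
    have hprod : ∏ x : X, (if x ∈ T then 2 ^ r else 1) = 2 ^ (r * t) := by
      rw [Finset.prod_ite_mem]
      simp [hTt, pow_mul]
    rw [Fintype.card_piFinset, ← hprod, ← Finset.prod_mul_distrib, Fintype.card_fun (α := X),
      ← Finset.card_univ (α := X), ← Finset.prod_const]
    refine Finset.prod_le_prod' fun x _ => ?_
    split_ifs
    · exact hB
    · simp
  have hbad : ∀ t, 1 ≤ t → (bad t).card * 2 ^ (k + 1) ≤ Fintype.card (X → Fin D → Y) := by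
    intro t ht
    have hTcard : (Finset.powersetCard t (Finset.univ : Finset X)).card ≤ 2 ^ (k * t) := by
      rw [Finset.card_powersetCard, Finset.card_univ, hX, pow_mul]
      exact Nat.choose_le_pow _ _
    have h₁ : (bad t).card * 2 ^ (r * t) ≤
        2 ^ (2 * k * t) * (2 ^ (k * t) * Fintype.card (X → Fin D → Y)) := by
      calc (bad t).card * 2 ^ (r * t) ≤ (∑ S ∈ fam t,
            ∑ T ∈ Finset.powersetCard t (Finset.univ : Finset X),
              (Fintype.piFinset fun x => if x ∈ T then B S else Finset.univ).card) *
                2 ^ (r * t) := by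
            refine Nat.mul_le_mul_right _ (Finset.card_biUnion_le.trans ?_)
            exact Finset.sum_le_sum fun S _ => Finset.card_biUnion_le
        _ = ∑ S ∈ fam t, ∑ T ∈ Finset.powersetCard t (Finset.univ : Finset X),
              (Fintype.piFinset fun x => if x ∈ T then B S else Finset.univ).card *
                2 ^ (r * t) := by
            simp only [Finset.sum_mul]
        _ ≤ ∑ S ∈ fam t, ∑ T ∈ Finset.powersetCard t (Finset.univ : Finset X),
              Fintype.card (X → Fin D → Y) :=
            Finset.sum_le_sum fun S hS => Finset.sum_le_sum fun T hT => hpi t S hS T hT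
        _ ≤ _ := by
            simp only [Finset.sum_const, smul_eq_mul]
            exact Nat.mul_le_mul (hfam t ht) (Nat.mul_le_mul_right _ hTcard)
    have hexp : k + 1 + 3 * k * t ≤ r * t := by nlinarith
    have h₂ : (bad t).card * 2 ^ (k + 1) * 2 ^ (3 * k * t) ≤
        Fintype.card (X → Fin D → Y) * 2 ^ (3 * k * t) := by
      calc (bad t).card * 2 ^ (k + 1) * 2 ^ (3 * k * t)
          = (bad t).card * 2 ^ (k + 1 + 3 * k * t) := by rw [pow_add]; ring
        _ ≤ (bad t).card * 2 ^ (r * t) := by gcongr; norm_num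
        _ ≤ _ := h₁
        _ = Fintype.card (X → Fin D → Y) * 2 ^ (2 * k * t + k * t) := by rw [pow_add]; ring
        _ = _ := by congr 2; ring
    exact Nat.le_of_mul_le_mul_right h₂ (by positivity)
  have htotal : ((Finset.Icc 1 (2 ^ k)).biUnion bad).card < Fintype.card (X → Fin D → Y) := by
    have h₁ : ((Finset.Icc 1 (2 ^ k)).biUnion bad).card * 2 ^ (k + 1) ≤
        2 ^ k * Fintype.card (X → Fin D → Y) := by
      calc _ ≤ (∑ t ∈ Finset.Icc 1 (2 ^ k), (bad t).card) * 2 ^ (k + 1) :=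
            Nat.mul_le_mul_right _ Finset.card_biUnion_le
        _ ≤ ∑ t ∈ Finset.Icc 1 (2 ^ k), Fintype.card (X → Fin D → Y) := by
            rw [Finset.sum_mul]
            exact Finset.sum_le_sum fun t ht => hbad t (Finset.mem_Icc.1 ht).1
        _ = _ := by simp
    have h₂ : ((Finset.Icc 1 (2 ^ k)).biUnion bad).card * 2 ≤ Fintype.card (X → Fin D → Y) := by
      refine le_of_mul_le_mul_left (a := 2 ^ k) ?_ (Nat.two_pow_pos k)
      calc _ = ((Finset.Icc 1 (2 ^ k)).biUnion bad).card * 2 ^ (k + 1) := by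
            rw [pow_succ]; ring
        _ ≤ _ := h₁
    omega
  obtain ⟨F, -, hF⟩ : ∃ F ∈ (Finset.univ : Finset (X → Fin D → Y)),
      F ∉ (Finset.Icc 1 (2 ^ k)).biUnion bad :=
    Finset.exists_mem_notMem_of_card_lt_card (by rwa [Finset.card_univ])
  refine ⟨F, fun t ht S hS T hT => ?_⟩
  by_contra! hcon
  refine hF (Finset.mem_biUnion.2 ⟨t, Finset.mem_Icc.2 ⟨ht, ?_⟩, Finset.mem_biUnion.2
    ⟨S, hS, Finset.mem_biUnion.2 ⟨T, Finset.mem_powersetCard.2 ⟨Finset.subset_univ _, hT⟩, ?_⟩⟩⟩)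
  · rw [← hT, ← hX]
    exact Finset.card_le_univ T
  · refine Fintype.mem_piFinset.2 fun x => ?_
    split_ifs with hx
    · exact Finset.mem_filter.2 ⟨Finset.mem_univ _, hcon x hx⟩
    · exact Finset.mem_univ _

theorem PrimrecPred.forall_mem {α β : Type} [Primcodable α] [Primcodable β] {L : α → List β}
    {p : α → β → Prop} (hL : Primrec L) (hp : PrimrecRel p) :
    PrimrecPred fun a => ∀ b ∈ L a, p a b :=
  (PrimrecRel.forall_mem_list (R := fun b a => p a b) hp.swap).comp hL Primrec.id

theorem PrimrecPred.exists_mem {α β : Type} [Primcodable α] [Primcodable β] {L : α → List β}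
    {p : α → β → Prop} (hL : Primrec L) (hp : PrimrecRel p) :
    PrimrecPred fun a => ∃ b ∈ L a, p a b :=
  (PrimrecRel.exists_mem_list (R := fun b a => p a b) hp.swap).comp hL Primrec.id

theorem Primrec.list_filter_rel {α β : Type} [Primcodable α] [Primcodable β] {L : α → List β}
    {p : α → β → Prop} [DecidableRel p] (hL : Primrec L) (hp : PrimrecRel p) :
    Primrec fun a => (L a).filter fun b => p a b :=
  (PrimrecRel.listFilter (R := fun b a => p a b) hp.swap).comp hL Primrec.id

theorem Primrec.list_sublists' {α : Type} [Primcodable α] :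
    Primrec (List.sublists' : List α → List (List α)) := by
  have h : Primrec fun L : List α => L.foldr (fun a M => M ++ M.map (List.cons a)) [[]] := by
    refine Primrec.list_foldr (h := fun (_ : List α) (x : α × List (List α)) =>
      x.2 ++ x.2.map (List.cons x.1)) Primrec.id (Primrec.const [[]]) ?_
    refine Primrec.list_append.comp (Primrec.snd.comp Primrec.snd)
      (Primrec.list_map (Primrec.snd.comp Primrec.snd) ?_)
    exact Primrec.list_cons.comp (Primrec.fst.comp (Primrec.snd.comp Primrec.fst)) Primrec.snd
  refine h.of_eq fun L => ?_
  induction L with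
  | nil => simp
  | cons a l ih => rw [List.foldr_cons, ih, List.sublists'_cons]

/-- The list of all binary strings of length `k`. -/
def allStr (k : ℕ) : List Str :=
  Nat.rec [[]] (fun _ L => L.map (List.cons false) ++ L.map (List.cons true)) k

theorem allStr_succ (k : ℕ) :
    allStr (k + 1) = (allStr k).map (List.cons false) ++ (allStr k).map (List.cons true) := rfl

theorem mem_allStr {k : ℕ} {w : Str} : w ∈ allStr k ↔ w.length = k := by
  induction k generalizing w with
  | zero => simp [allStr]
  | succ k ih =>
    rw [allStr_succ]
    cases w with
    | nil => simp
    | cons b w => cases b <;> simp [ih]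

theorem length_allStr (k : ℕ) : (allStr k).length = 2 ^ k := by
  induction k with
  | zero => simp [allStr]
  | succ k ih => rw [allStr_succ]; simp [ih]; ring

theorem nodup_allStr (k : ℕ) : (allStr k).Nodup := by
  induction k with
  | zero => simp [allStr]
  | succ k ih =>
    rw [allStr_succ]
    refine List.Nodup.append (ih.map (List.cons_injective)) (ih.map (List.cons_injective)) ?_
    intro w h₁ h₂
    obtain ⟨u, -, rfl⟩ := List.mem_map.1 h₁
    obtain ⟨v, -, hv⟩ := List.mem_map.1 h₂
    simp at hv

theorem primrec_allStr : Primrec allStr := by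
  refine Primrec.nat_rec₁ (f := fun _ (L : List Str) =>
    L.map (List.cons false) ++ L.map (List.cons true)) [[]] ?_
  refine Primrec.list_append.comp (Primrec.list_map Primrec.snd ?_)
    (Primrec.list_map Primrec.snd ?_)
  · exact Primrec.list_cons.comp (Primrec.const false) Primrec.snd
  · exact Primrec.list_cons.comp (Primrec.const true) Primrec.snd

theorem primrec_two_pow : Primrec fun n : ℕ => 2 ^ n :=
  (Primrec.list_length.comp primrec_allStr).of_eq length_allStr

/-- The number with a given binary expansion. -/
def strVal (w : Str) : ℕ := w.foldl (fun n b => 2 * n + b.toNat) 0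

theorem strVal_append (w : Str) (b : Bool) : strVal (w ++ [b]) = 2 * strVal w + b.toNat := by
  simp [strVal]

theorem exists_strVal_eq (s j : ℕ) (hj : j < 2 ^ s) : ∃ w : Str, w.length = s ∧ strVal w = j := by
  induction s generalizing j with
  | zero => exact ⟨[], rfl, by simp at hj; simp [strVal, hj]⟩
  | succ s ih =>
    obtain ⟨w, hw, hv⟩ := ih (j / 2) (by rw [pow_succ] at hj; omega)
    refine ⟨w ++ [decide (j % 2 = 1)], by simp [hw], ?_⟩
    rw [strVal_append, hv]
    rcases Nat.mod_two_eq_zero_or_one j with h | h <;> simp [h] <;> omega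

theorem strVal_lt (w : Str) : strVal w < 2 ^ w.length := by
  induction w using List.reverseRecOn with
  | nil => simp [strVal]
  | append_singleton w b ih =>
    rw [strVal_append, List.length_append, List.length_singleton, pow_succ]
    have := Bool.toNat_le b
    omega

theorem strVal_inj {v w : Str} (hl : v.length = w.length) (h : strVal v = strVal w) : v = w := by
  induction v using List.reverseRecOn generalizing w with
  | nil => simpa using hl.symm
  | append_singleton v b ih =>
    induction w using List.reverseRecOn with
    | nil => simp at hl
    | append_singleton w c _ =>
      rw [strVal_append, strVal_append] at h
      have hb := Bool.toNat_le b
      have hc := Bool.toNat_le c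
      have hbc : b.toNat = c.toNat := by omega
      rw [ih (w := w) (by simpa using hl) (by omega)]
      cases b <;> cases c <;> simp_all

theorem primrec_strVal : Primrec strVal := by
  refine Primrec.list_foldl (h := fun (_ : Str) (x : ℕ × Bool) => 2 * x.1 + x.2.toNat)
    Primrec.id (Primrec.const 0) ?_
  refine Primrec.nat_add.comp (Primrec.nat_double.comp (Primrec.fst.comp Primrec.snd)) ?_
  exact (Primrec.dom_finite Bool.toNat).comp (Primrec.snd.comp Primrec.snd)

theorem exists_hash (k D r : ℕ) (hr : 4 * k < r) :
    ∃ F : Str → ℕ → Str, (∀ x i, (F x i).length = k) ∧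
      ∀ l ≤ k, ∀ S : Finset Str, (∀ w ∈ S, w.length = l) → S.card * (2 * D) ≤ 2 ^ l →
        ∀ T : Finset Str, (∀ x ∈ T, x.length = k) →
          (∀ x ∈ T, r ≤ ((Finset.range D).filter fun i => (F x i).take l ∈ S).card) →
            T.card ≤ S.card := by
  classical
  let X := List.Vector Bool k
  have hX : Fintype.card X = 2 ^ k := by simp [X, card_vector]
  let cyl : ℕ → Finset Str → Finset X := fun l S =>
    Finset.univ.filter fun y => y.toList.take l ∈ S
  have hcyl : ∀ l ≤ k, ∀ S : Finset Str, (cyl l S).card ≤ S.card * 2 ^ (k - l) := by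
    intro l hl S
    have hcard : (S ×ˢ (allStr (k - l)).toFinset).card = S.card * 2 ^ (k - l) := by
      rw [Finset.card_product, List.toFinset_card_of_nodup (nodup_allStr _), length_allStr]
    rw [← hcard]
    refine Finset.card_le_card_of_injOn (fun y => (y.toList.take l, y.toList.drop l)) ?_ ?_
    · intro y hy
      simpa [cyl, mem_allStr] using hy
    · intro y _ z _ hyz
      simp only [Prod.mk.injEq] at hyz
      apply List.Vector.toList_injective
      rw [← List.take_append_drop l y.toList, hyz.1, hyz.2, List.take_append_drop]
  let fam : ℕ → Finset (Finset X) := fun t => (Finset.range (k + 1)).biUnion fun l =>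
    ((Finset.powersetCard t (allStr l).toFinset).filter
      fun S => S.card * (2 * D) ≤ 2 ^ l).image (cyl l)
  obtain ⟨F, hF⟩ := exists_hash_of_family (X := X) (Y := X) k D r hX hr fam (by
    intro t ht
    calc (fam t).card ≤ (Finset.range (k + 1)).card * 2 ^ (k * t) := by
          refine Finset.card_biUnion_le_card_mul _ _ _ fun l hl => ?_
          refine Finset.card_image_le.trans ((Finset.card_filter_le _ _).trans ?_)
          rw [Finset.card_powersetCard, List.toFinset_card_of_nodup (nodup_allStr _),
            length_allStr, pow_mul]
          refine (Nat.choose_le_pow _ _).trans (Nat.pow_le_pow_left ?_ _)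
          exact Nat.pow_le_pow_right (by norm_num) (by simpa [Nat.lt_succ_iff] using hl)
      _ ≤ 2 ^ (k * t) * 2 ^ (k * t) := by
          refine Nat.mul_le_mul_right _ ?_
          rw [Finset.card_range]
          exact (Nat.lt_two_pow_self (n := k)).trans_le
            (Nat.pow_le_pow_right (by norm_num) (Nat.le_mul_of_pos_right _ ht))
      _ = 2 ^ (2 * k * t) := by rw [← pow_add]; congr 1; ring) (by
    intro t S' hS'
    obtain ⟨l, hl, hS'⟩ := Finset.mem_biUnion.1 hS'
    obtain ⟨S, hS, rfl⟩ := Finset.mem_image.1 hS'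
    have hlk : l ≤ k := by simpa [Nat.lt_succ_iff] using hl
    calc (cyl l S).card * (2 * D) ≤ S.card * 2 ^ (k - l) * (2 * D) :=
          Nat.mul_le_mul_right _ (hcyl l hlk S)
      _ = S.card * (2 * D) * 2 ^ (k - l) := by ring
      _ ≤ 2 ^ l * 2 ^ (k - l) := Nat.mul_le_mul_right _ (Finset.mem_filter.1 hS).2
      _ = Fintype.card X := by rw [← pow_add, Nat.add_sub_cancel' hlk, hX])
  refine ⟨fun x i => if h : x.length = k ∧ i < D then (F ⟨x, h.1⟩ ⟨i, h.2⟩).toList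
    else List.replicate k false, fun x i => ?_, ?_⟩
  · dsimp only
    split_ifs
    · exact List.Vector.toList_length _
    · simp
  · intro l hl S hSl hSD T hTk hT
    by_contra! hlt
    obtain ⟨T', hT'T, hT'S⟩ := Finset.exists_subset_card_eq hlt.le
    rcases Nat.eq_zero_or_pos S.card with h0 | hpos
    · rw [h0] at hlt
      obtain ⟨x, hx⟩ := Finset.card_pos.1 hlt
      have := hT x hx
      rw [Finset.card_eq_zero.1 h0] at this
      simp at this
      omega
    let T'' : Finset X := Finset.univ.filter fun x => x.toList ∈ T'
    have hT'' : T''.card = S.card := by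
      rw [← hT'S]
      refine Finset.card_bij (fun x _ => x.toList) ?_ ?_ ?_
      · intro x hx
        exact (Finset.mem_filter.1 hx).2
      · intro x _ y _ hxy
        exact List.Vector.toList_injective hxy
      · intro x hx
        exact ⟨⟨x, hTk x (hT'T hx)⟩, Finset.mem_filter.2 ⟨Finset.mem_univ _, hx⟩, rfl⟩
    obtain ⟨x, hx, hxr⟩ := hF S.card hpos (cyl l S) (by
      refine Finset.mem_biUnion.2 ⟨l, by simpa [Nat.lt_succ_iff] using hl,
        Finset.mem_image.2 ⟨S, ?_, rfl⟩⟩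
      refine Finset.mem_filter.2 ⟨Finset.mem_powersetCard.2 ⟨fun w hw => ?_, rfl⟩, hSD⟩
      simpa [mem_allStr] using hSl w hw) T'' hT''
    have := hT x.toList (hT'T (Finset.mem_filter.1 hx).2)
    refine absurd (this.trans ?_) (not_le.2 hxr)
    refine Finset.card_le_card_of_injOn (fun i => if h : i < D then ⟨i, h⟩ else ⟨0, ?_⟩) ?_ ?_
    · by_contra hD
      obtain rfl : D = 0 := by omega
      simp at this
      omega
    · intro i hi
      obtain ⟨hiD, hi⟩ := Finset.mem_filter.1 hi
      have hiD' := Finset.mem_range.1 hiD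
      have hxk : x.toList.length = k := x.toList_length
      simp only [hxk, hiD', and_self, dif_pos] at hi ⊢
      simpa [cyl] using hi
    · intro i hi j hj hij
      have hi' := Finset.mem_range.1 (Finset.mem_filter.1 hi).1
      have hj' := Finset.mem_range.1 (Finset.mem_filter.1 hj).1
      simpa [hi', hj'] using hij

/-- The number of functions in the hash family with parameter `N`. -/
def hashDeg (N : ℕ) : ℕ := 4 * (N + 2) ^ 3

theorem primrec_hashDeg : Primrec hashDeg := by
  have h : Primrec fun N : ℕ => N + 2 := Primrec.nat_add.comp Primrec.id (Primrec.const 2)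
  refine (Primrec.nat_mul.comp (Primrec.const 4)
    (Primrec.nat_mul.comp (Primrec.nat_mul.comp h h) h)).of_eq fun N => ?_
  simp only [hashDeg]
  ring

/-- The value at `x` of the `i`-th function of the family tabulated by `F`. -/
def hashApp (F : List (List Str)) (x : Str) (i : ℕ) : Str := (F.getD (strVal x) []).getD i []

theorem primrec_hashApp :
    Primrec fun y : List (List Str) × Str × ℕ => hashApp y.1 y.2.1 y.2.2 :=
  (Primrec.list_getD []).comp
    ((Primrec.list_getD []).comp Primrec.fst
      (primrec_strVal.comp (Primrec.fst.comp Primrec.snd)))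
    (Primrec.snd.comp Primrec.snd)

/-- The indices of the functions in the family that send `x` to a string whose `l`-bit prefix
is in `S`. -/
def hashHits (N l : ℕ) (F : List (List Str)) (S : List Str) (x : Str) : List ℕ :=
  (List.range (hashDeg N)).filter fun i => ∃ w ∈ S, w = (hashApp F x i).take l

theorem primrec_hashHits : Primrec fun y : ((ℕ × ℕ) × List (List Str) × List Str) × Str =>
    hashHits y.1.1.1 y.1.1.2 y.1.2.1 y.1.2.2 y.2 := by
  refine Primrec.list_filter_rel
    (p := fun (y : ((ℕ × ℕ) × List (List Str) × List Str) × Str) (i : ℕ) =>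
      ∃ w ∈ y.1.2.2, w = (hashApp y.1.2.1 y.2 i).take y.1.1.2)
    (Primrec.list_range.comp (primrec_hashDeg.comp
      (Primrec.fst.comp (Primrec.fst.comp Primrec.fst)))) ?_
  refine PrimrecPred.exists_mem
    (α := (((ℕ × ℕ) × List (List Str) × List Str) × Str) × ℕ)
    (p := fun y w => w = (hashApp y.1.1.2.1 y.1.2 y.2).take y.1.1.1.2)
    (Primrec.snd.comp (Primrec.snd.comp (Primrec.fst.comp Primrec.fst))) ?_
  have happ : Primrec fun y : ((((ℕ × ℕ) × List (List Str) × List Str) × Str) × ℕ) × Str =>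
      hashApp y.1.1.1.2.1 y.1.1.2 y.1.2 :=
    primrec_hashApp.comp
      (g := fun y : ((((ℕ × ℕ) × List (List Str) × List Str) × Str) × ℕ) × Str =>
        (y.1.1.1.2.1, y.1.1.2, y.1.2)) (Primrec.pair
        (Primrec.fst.comp (Primrec.snd.comp
          (Primrec.fst.comp (Primrec.fst.comp Primrec.fst))))
        (Primrec.pair (Primrec.snd.comp (Primrec.fst.comp Primrec.fst))
          (Primrec.snd.comp Primrec.fst)))
  refine Primrec.eq.comp Primrec.snd (Primrec.list_take.comp ?_ happ)
  exact Primrec.snd.comp (Primrec.fst.comp (Primrec.fst.comp (Primrec.fst.comp Primrec.fst)))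

/-- A table of hash functions from `k`-bit strings to `k`-bit strings such that, for each set `S`
of `l`-bit strings of density at most `1 / (2 * hashDeg N)`, at most `S.length` points have more
than `4 * N` hash values with `l`-bit prefix in `S`. -/
def GoodHash (N k : ℕ) (F : List (List Str)) : Prop :=
  (∀ x ∈ allStr k, ∀ i ∈ List.range (hashDeg N), (hashApp F x i).length = k) ∧
  ∀ l ∈ List.range (k + 1), ∀ S ∈ (allStr l).sublists',
    ¬ S.length * (2 * hashDeg N) ≤ 2 ^ l ∨
      ((allStr k).filter fun x => 4 * N + 1 ≤ (hashHits N l F S x).length).length ≤ S.length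

theorem primrec_goodHash :
    PrimrecPred fun y : (ℕ × ℕ) × List (List Str) => GoodHash y.1.1 y.1.2 y.2 := by
  refine PrimrecPred.and ?_ ?_
  · refine PrimrecPred.forall_mem (primrec_allStr.comp (Primrec.snd.comp Primrec.fst)) ?_
    refine PrimrecPred.forall_mem (α := ((ℕ × ℕ) × List (List Str)) × Str)
      (Primrec.list_range.comp (primrec_hashDeg.comp
        (Primrec.fst.comp (Primrec.fst.comp Primrec.fst)))) ?_
    refine Primrec.eq.comp (Primrec.list_length.comp (primrec_hashApp.comp (Primrec.pair
      (Primrec.snd.comp (Primrec.fst.comp Primrec.fst))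
      (Primrec.pair (Primrec.snd.comp Primrec.fst) Primrec.snd)))) ?_
    exact Primrec.snd.comp (Primrec.fst.comp (Primrec.fst.comp Primrec.fst))
  · refine PrimrecPred.forall_mem (Primrec.list_range.comp
      (Primrec.succ.comp (Primrec.snd.comp Primrec.fst))) ?_
    refine PrimrecPred.forall_mem (α := ((ℕ × ℕ) × List (List Str)) × ℕ)
      (Primrec.list_sublists'.comp (primrec_allStr.comp Primrec.snd)) ?_
    have hN : Primrec fun z : (((ℕ × ℕ) × List (List Str)) × ℕ) × List Str => z.1.1.1.1 :=
      Primrec.fst.comp (Primrec.fst.comp (Primrec.fst.comp Primrec.fst))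
    refine PrimrecPred.or (PrimrecPred.not ?_) ?_
    · exact Primrec.nat_le.comp (Primrec.nat_mul.comp (Primrec.list_length.comp Primrec.snd)
        (Primrec.nat_double.comp (primrec_hashDeg.comp hN)))
        (primrec_two_pow.comp (Primrec.snd.comp Primrec.fst))
    · refine Primrec.nat_le.comp (Primrec.list_length.comp ?_)
        (Primrec.list_length.comp Primrec.snd)
      refine Primrec.list_filter_rel
        (p := fun (z : (((ℕ × ℕ) × List (List Str)) × ℕ) × List Str) (x : Str) =>
          4 * z.1.1.1.1 + 1 ≤ (hashHits z.1.1.1.1 z.1.2 z.1.1.2 z.2 x).length)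
        (primrec_allStr.comp
          (Primrec.snd.comp (Primrec.fst.comp (Primrec.fst.comp Primrec.fst)))) ?_
      have hhits : Primrec fun z : ((((ℕ × ℕ) × List (List Str)) × ℕ) × List Str) × Str =>
          hashHits z.1.1.1.1.1 z.1.1.2 z.1.1.1.2 z.1.2 z.2 :=
        primrec_hashHits.comp
          (g := fun z : ((((ℕ × ℕ) × List (List Str)) × ℕ) × List Str) × Str =>
            (((z.1.1.1.1.1, z.1.1.2), z.1.1.1.2, z.1.2), z.2))
          (Primrec.pair (Primrec.pair (Primrec.pair (hN.comp Primrec.fst)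
            (Primrec.snd.comp (Primrec.fst.comp Primrec.fst)))
            (Primrec.pair (Primrec.snd.comp (Primrec.fst.comp (Primrec.fst.comp Primrec.fst)))
              (Primrec.snd.comp Primrec.fst))) Primrec.snd)
      exact Primrec.nat_le.comp (Primrec.succ.comp (Primrec.nat_mul.comp (Primrec.const 4)
        (hN.comp Primrec.fst))) (Primrec.list_length.comp hhits)

theorem exists_goodHash {N k : ℕ} (hk : k ≤ N) : ∃ F, GoodHash N k F := by
  classical
  obtain ⟨G, hGk, hG⟩ := exists_hash k (hashDeg N) (4 * N + 1) (by omega)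
  have hinj : Set.InjOn strVal {x : Str | x.length = k} := fun x hx y hy h =>
    strVal_inj (Eq.trans hx (Eq.symm hy)) h
  let F : List (List Str) := (List.range (2 ^ k)).map fun j =>
    (List.range (hashDeg N)).map fun i => G (Function.invFunOn strVal {x : Str | x.length = k} j) i
  have hF : ∀ x : Str, x.length = k → ∀ i < hashDeg N, hashApp F x i = G x i := by
    intro x hx i hi
    have hlt : strVal x < 2 ^ k := hx ▸ strVal_lt x
    have hinv : Function.invFunOn strVal {x : Str | x.length = k} (strVal x) = x :=
      hinj.leftInvOn_invFunOn hx
    simp [hashApp, F, List.getD_eq_getElem?_getD, hlt, hi, hinv]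
  refine ⟨F, fun x hx i hi => ?_, fun l hl S hS => ?_⟩
  · rw [hF x (mem_allStr.1 hx) i (List.mem_range.1 hi)]
    exact hGk x i
  · rw [or_iff_not_imp_left, not_not]
    intro hSD
    have hsub := List.mem_sublists'.1 hS
    have hnd : S.Nodup := hsub.nodup (nodup_allStr l)
    have hcard : S.toFinset.card = S.length := List.toFinset_card_of_nodup hnd
    have := hG l (by simpa [Nat.lt_succ_iff] using hl) S.toFinset (fun w hw =>
      mem_allStr.1 (hsub.subset (List.mem_toFinset.1 hw))) (by rwa [hcard])
      ((allStr k).filter fun x => 4 * N + 1 ≤ (hashHits N l F S x).length).toFinset ?_ ?_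
    · rwa [hcard, List.toFinset_card_of_nodup ((nodup_allStr k).filter _)] at this
    · intro x hx
      exact mem_allStr.1 (List.mem_filter.1 (List.mem_toFinset.1 hx)).1
    · intro x hx
      obtain ⟨hxk, hx⟩ := List.mem_filter.1 (List.mem_toFinset.1 hx)
      refine (of_decide_eq_true hx).trans ?_
      rw [hashHits, ← List.toFinset_card_of_nodup (List.nodup_range.filter _)]
      refine Finset.card_le_card fun i hi => ?_
      obtain ⟨hi₁, hi₂⟩ := List.mem_filter.1 (List.mem_toFinset.1 hi)
      rw [List.mem_range] at hi₁
      rw [hF x (mem_allStr.1 hxk) i hi₁] at hi₂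
      simpa [hi₁] using hi₂

/-- Finset form of the defining property of `GoodHash`. -/
theorem GoodHash.card_le {N k : ℕ} {F : List (List Str)} (hF : GoodHash N k F) {l : ℕ}
    (hl : l ≤ k) (S T : Finset Str) (hS : ∀ w ∈ S, w.length = l)
    (hSD : S.card * (2 * hashDeg N) ≤ 2 ^ l) (hTk : ∀ x ∈ T, x.length = k)
    (hT : ∀ x ∈ T, 4 * N + 1 ≤
      ((Finset.range (hashDeg N)).filter fun i => (hashApp F x i).take l ∈ S).card) :
    T.card ≤ S.card := by
  classical
  let S' := (allStr l).filter fun w => w ∈ S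
  have hS'S : S'.toFinset = S := by
    ext w
    simp only [S', List.mem_toFinset, List.mem_filter, mem_allStr, decide_eq_true_eq]
    exact ⟨fun h => h.2, fun h => ⟨hS w h, h⟩⟩
  have hlen : S'.length = S.card := by
    rw [← hS'S, List.toFinset_card_of_nodup ((nodup_allStr l).filter _)]
  have hmem : ∀ w, w ∈ S' ↔ w ∈ S := fun w => by rw [← hS'S, List.mem_toFinset]
  have h := (hF.2 l (by simpa [Nat.lt_succ_iff] using hl) S'
    (List.mem_sublists'.2 List.filter_sublist)).resolve_left (by rwa [not_not, hlen])
  rw [hlen, ← List.toFinset_card_of_nodup ((nodup_allStr k).filter _)] at h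
  refine (Finset.card_le_card fun x hx => ?_).trans h
  simp only [List.mem_toFinset, List.mem_filter, mem_allStr, decide_eq_true_eq]
  refine ⟨hTk x hx, (hT x hx).trans ?_⟩
  rw [hashHits, ← List.toFinset_card_of_nodup (List.nodup_range.filter _)]
  refine Finset.card_le_card fun i hi => ?_
  simpa [hmem] using hi

theorem one_le_log2 (n : ℕ) : 1 ≤ log2 n :=
  Nat.log_pos (by norm_num) (by omega)

theorem lt_two_pow_log2 (n : ℕ) : n + 2 < 2 ^ (log2 n + 1) :=
  Nat.lt_pow_succ_log_self (by norm_num) _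

theorem log2_mono {m n : ℕ} (h : m ≤ n) : log2 m ≤ log2 n :=
  Nat.log_mono_right (by omega)

section Complexity

variable {U : CondMachine}

theorem condC_le_length {V : CondMachine} {p x y : Str} (h : x ∈ V.1 (p, y)) :
    condC V x y ≤ p.length :=
  sInf_le ⟨p, h, rfl⟩

theorem KC_le_length_of_machine (hU : OptimalMachine U) (V : CondMachine) :
    ∃ d : ℕ, ∀ p x y : Str, x ∈ V.1 (p, y) → KC U x y ≤ p.length + d := by
  obtain ⟨d, hd⟩ := hU V
  refine ⟨d, fun p x y h => ENat.toNat_le_of_le_natCast ((hd x y).trans ?_)⟩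
  push_cast
  gcongr
  exact condC_le_length h

/-- The machine printing its program. -/
def printMachine : CondMachine := ⟨fun q => Part.some q.1, Computable.fst.partrec⟩

theorem KC_le_length (hU : OptimalMachine U) : ∃ d : ℕ, ∀ x y : Str, KC U x y ≤ x.length + d := by
  obtain ⟨d, hd⟩ := KC_le_length_of_machine hU printMachine
  exact ⟨d, fun x y => hd x x y (Part.mem_some x)⟩

theorem exists_program (hU : OptimalMachine U) (x y : Str) :
    ∃ p : Str, p.length = KC U x y ∧ x ∈ U.1 (p, y) := by
  obtain ⟨d, hd⟩ := hU printMachine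
  have hne : {n : ℕ∞ | ∃ p : Str, x ∈ U.1 (p, y) ∧ (p.length : ℕ∞) = n}.Nonempty := by
    by_contra hcon
    have htop : condC U x y = ⊤ := by
      rw [condC, Set.not_nonempty_iff_eq_empty.1 hcon, sInf_empty]
    have hle := (hd x y).trans (add_le_add_left
      (condC_le_length (V := printMachine) (p := x) (Part.mem_some x)) _)
    rw [htop, top_le_iff] at hle
    exact ENat.natCast_ne_top (x.length + d) (by exact_mod_cast hle)
  obtain ⟨p, hp, hlen⟩ := csInf_mem hne
  refine ⟨p, ?_, hp⟩
  rw [KC, condC, ← hlen, ENat.toNat_natCast]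

theorem unary_prefix_inj {u u' v v' : Str}
    (h : (List.range u.length).map (fun _ => true) ++ false :: (u ++ v) =
      (List.range u'.length).map (fun _ => true) ++ false :: (u' ++ v')) :
    u = u' ∧ v = v' := by
  have key : ∀ (m m' : ℕ) (w w' : Str), List.replicate m true ++ false :: w =
      List.replicate m' true ++ false :: w' → m = m' ∧ w = w' := by
    intro m
    induction m with
    | zero => intro m' w w' h; cases m' <;> simp_all [List.replicate_succ]
    | succ m ih =>
      intro m' w w' h
      cases m' with
      | zero => simp [List.replicate_succ] at h
      | succ m' =>
        simp only [List.replicate_succ, List.cons_append, List.cons.injEq, true_and] at h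
        simpa using ih m' w w' h
  simp only [List.map_const', List.length_range] at h
  obtain ⟨hlen, happ⟩ := key _ _ _ _ h
  exact List.append_inj happ hlen

theorem encode_quadruple_lt {N e₁ e₂ e₃ e₄ : ℕ} (h₁ : e₁ ≤ N) (h₂ : e₂ ≤ N) (h₃ : e₃ ≤ N)
    (h₄ : e₄ ≤ N) : Encodable.encode (e₁, e₂, e₃, e₄) < 2 ^ (8 * (log2 N + 1)) := by
  have hpair : ∀ {a b M : ℕ}, a < M → b < M → Nat.pair a b < M ^ 2 := by
    intro a b M ha hb
    refine (Nat.pair_lt_max_add_one_sq a b).trans_le (Nat.pow_le_pow_left ?_ 2)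
    exact Nat.succ_le_of_lt (max_lt ha hb)
  have hM : N + 1 ≤ (N + 1) ^ 2 := Nat.le_self_pow (by norm_num) _
  have hM' : N + 1 ≤ ((N + 1) ^ 2) ^ 2 := hM.trans (Nat.le_self_pow (by norm_num) _)
  simp only [Encodable.encode_prod_val, Encodable.encode_nat]
  calc Nat.pair e₁ (Nat.pair e₂ (Nat.pair e₃ e₄)) < (((N + 1) ^ 2) ^ 2) ^ 2 :=
        hpair (by omega) (hpair (by omega) (hpair (by omega) (by omega)))
    _ = (N + 1) ^ 8 := by ring
    _ ≤ (2 ^ (log2 N + 1)) ^ 8 :=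
        Nat.pow_le_pow_left (by have := lt_two_pow_log2 N; omega) 8
    _ = _ := by rw [← pow_mul, mul_comm]

/-- The elements of a finite set enumerated uniformly in a condition and four numerical parameters
have conditional complexity at most the logarithm of the size of the set, up to the cost of the
parameters. -/
theorem KC_le_of_sigmaOne (hU : OptimalMachine U) {A : ((ℕ × ℕ × ℕ × ℕ) × Str) × Str → Prop}
    (hA : SigmaOne A) :
    ∃ c : ℕ, ∀ N e₁ e₂ e₃ e₄ : ℕ, e₁ ≤ N → e₂ ≤ N → e₃ ≤ N → e₄ ≤ N →
      ∀ (y x : Str) (s : ℕ) (G : Finset Str), (∀ x', A (((e₁, e₂, e₃, e₄), y), x') → x' ∈ G) →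
        G.card ≤ 2 ^ s → A (((e₁, e₂, e₃, e₄), y), x) → KC U x y ≤ s + c * log2 N := by
  obtain ⟨q, hq, hq_unique, hq_num⟩ := hA.exists_numbering
  let M : (Str × Str) × Str → Prop := fun z => ∃ w : Str × Str,
    z.1.1 = (List.range w.1.length).map (fun _ => true) ++ false :: (w.1 ++ w.2) ∧
      q (((Denumerable.ofNat (ℕ × ℕ × ℕ × ℕ) (strVal w.1), z.1.2), strVal w.2), z.2)
  have hM : SigmaOne M := by
    refine SigmaOne.exists (p := fun v : ((Str × Str) × Str) × (Str × Str) =>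
      v.1.1.1 = (List.range v.2.1.length).map (fun _ => true) ++ false :: (v.2.1 ++ v.2.2) ∧
      q (((Denumerable.ofNat (ℕ × ℕ × ℕ × ℕ) (strVal v.2.1), v.1.1.2), strVal v.2.2), v.1.2))
      (SigmaOne.and (PrimrecPred.sigmaOne ?_) ?_)
    · refine Primrec.eq.comp (Primrec.fst.comp (Primrec.fst.comp Primrec.fst)) ?_
      have hw : Primrec fun v : ((Str × Str) × Str) × (Str × Str) => v.2.1 :=
        Primrec.fst.comp Primrec.snd
      refine Primrec.list_append.comp (Primrec.list_map
        (Primrec.list_range.comp (Primrec.list_length.comp hw)) (Primrec.const true).to₂) ?_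
      exact Primrec.list_cons.comp (Primrec.const false)
        (Primrec.list_append.comp hw (Primrec.snd.comp Primrec.snd))
    · refine hq.comp (f := fun v : ((Str × Str) × Str) × (Str × Str) =>
        (((Denumerable.ofNat (ℕ × ℕ × ℕ × ℕ) (strVal v.2.1), v.1.1.2), strVal v.2.2), v.1.2))
        (Primrec.pair (Primrec.pair (Primrec.pair ?_ ?_) ?_) ?_)
      · exact (Primrec.ofNat _).comp (primrec_strVal.comp (Primrec.fst.comp Primrec.snd))
      · exact Primrec.snd.comp (Primrec.fst.comp Primrec.fst)
      · exact primrec_strVal.comp (Primrec.snd.comp Primrec.snd)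
      · exact Primrec.snd.comp Primrec.fst
  obtain ⟨f, hf, hfM, hf_dom⟩ := hM.exists_partrec
  obtain ⟨d, hd⟩ := KC_le_length_of_machine hU ⟨f, hf⟩
  refine ⟨33 + d, fun N e₁ e₂ e₃ e₄ h₁ h₂ h₃ h₄ y x s G hG hGs hx => ?_⟩
  obtain ⟨j, hj, hqj⟩ := hq_num _ G hG x hx
  obtain ⟨u, hu, hue⟩ := exists_strVal_eq _ _ (encode_quadruple_lt h₁ h₂ h₃ h₄)
  obtain ⟨v, hv, hvj⟩ := exists_strVal_eq s j (hj.trans_le hGs)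
  let p : Str := (List.range u.length).map (fun _ => true) ++ false :: (u ++ v)
  have hMx : M ((p, y), x) := ⟨(u, v), rfl, by
    simp only [hue, hvj, Denumerable.ofNat_encode]
    exact hqj⟩
  have hmem : x ∈ f (p, y) := by
    have hdom := hf_dom _ _ hMx
    have hget := Part.get_mem hdom
    obtain ⟨⟨u', v'⟩, hp', hq'⟩ := hfM _ _ hget
    obtain ⟨rfl, rfl⟩ := unary_prefix_inj hp'
    simp only [hue, hvj, Denumerable.ofNat_encode] at hq'
    rwa [hq_unique _ _ _ _ hqj hq']
  have hlen : p.length = 16 * (log2 N + 1) + 1 + s := by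
    simp only [p, List.length_append, List.length_map, List.length_range, List.length_cons, hu, hv]
    ring
  have := hd p x y hmem
  have hlog := one_le_log2 N
  rw [hlen] at this
  nlinarith

end Complexity

theorem exists_finset_image {α β : Type} [Inhabited β] (Q : Finset α) (r : α → β → Prop)
    (hr : ∀ a b b', r a b → r a b' → b = b') :
    ∃ G : Finset β, (∀ a ∈ Q, ∀ b, r a b → b ∈ G) ∧ G.card ≤ Q.card := by
  classical
  refine ⟨Q.image fun a => Classical.epsilon (r a), fun a ha b hb => ?_, Finset.card_image_le⟩
  exact Finset.mem_image.2 ⟨a, ha, hr a _ _ (Classical.epsilon_spec ⟨b, hb⟩) hb⟩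

theorem card_allStr_toFinset (k : ℕ) : (allStr k).toFinset.card = 2 ^ k := by
  rw [List.toFinset_card_of_nodup (nodup_allStr k), length_allStr]

section Complexity

variable {U : CondMachine}

theorem CondMachine.sigmaOne (U : CondMachine) {α : Type} [Primcodable α] {p y x : α → Str}
    (hp : Primrec p) (hy : Primrec y) (hx : Primrec x) :
    SigmaOne fun a => x a ∈ U.1 (p a, y a) :=
  (Partrec.sigmaOne U.2).comp (f := fun a => ((p a, y a), x a))
    (Primrec.pair (Primrec.pair hp hy) hx)

theorem SigmaOne.length_eq {α : Type} [Primcodable α] {p : α → Str} {k : α → ℕ}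
    (hp : Primrec p) (hk : Primrec k) : SigmaOne fun a => (p a).length = k a :=
  PrimrecPred.sigmaOne (Primrec.eq.comp (Primrec.list_length.comp hp) hk)

theorem KC_cond_le (hU : OptimalMachine U) :
    ∃ d : ℕ, ∀ x y : Str, KC U x y ≤ KC U x [] + d := by
  obtain ⟨d, hd⟩ := KC_le_length_of_machine hU ⟨fun q => U.1 (q.1, []),
    U.2.comp (Computable.pair Computable.fst (Computable.const []))⟩
  refine ⟨d, fun x y => ?_⟩
  obtain ⟨p, hp, hx⟩ := exists_program hU x []
  exact hp ▸ hd p x y hx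

/-- Composing a description of `x` given `z` with a description of `y` given `x`. -/
theorem KC_comp_le (hU : OptimalMachine U) {g : Str × Str → Str} (hg : Computable g) :
    ∃ c : ℕ, ∀ (N : ℕ) (x y z : Str), KC U x z ≤ N → KC U y x ≤ N →
      KC U (g (x, y)) z ≤ KC U x z + KC U y x + c * log2 N := by
  let B : (((ℕ × ℕ × ℕ × ℕ) × Str) × Str) × ((Str × Str) × (Str × Str)) → Prop := fun v =>
    (v.2.1.1.length = v.1.1.1.1 ∧ v.2.1.2.length = v.1.1.1.2.1) ∧
      v.2.2.1 ∈ U.1 (v.2.1.1, v.1.1.2) ∧ v.2.2.2 ∈ U.1 (v.2.1.2, v.2.2.1) ∧ v.1.2 = g v.2.2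
  have hB : SigmaOne B := by
    have hz : Primrec fun v : (((ℕ × ℕ × ℕ × ℕ) × Str) × Str) × ((Str × Str) × (Str × Str)) =>
      v.1.1 := Primrec.fst.comp Primrec.fst
    have hp : Primrec fun v : (((ℕ × ℕ × ℕ × ℕ) × Str) × Str) × ((Str × Str) × (Str × Str)) =>
      v.2.1 := Primrec.fst.comp Primrec.snd
    have hx : Primrec fun v : (((ℕ × ℕ × ℕ × ℕ) × Str) × Str) × ((Str × Str) × (Str × Str)) =>
      v.2.2 := Primrec.snd.comp Primrec.snd
    refine SigmaOne.and (SigmaOne.and ?_ ?_) (SigmaOne.and ?_ (SigmaOne.and ?_ ?_))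
    · exact SigmaOne.length_eq (Primrec.fst.comp hp) (Primrec.fst.comp (Primrec.fst.comp hz))
    · exact SigmaOne.length_eq (Primrec.snd.comp hp)
        (Primrec.fst.comp (Primrec.snd.comp (Primrec.fst.comp hz)))
    · exact U.sigmaOne (Primrec.fst.comp hp) (Primrec.snd.comp hz) (Primrec.fst.comp hx)
    · exact U.sigmaOne (Primrec.snd.comp hp) (Primrec.fst.comp hx) (Primrec.snd.comp hx)
    · exact hg.sigmaOne.comp (Primrec.pair hx (Primrec.snd.comp Primrec.fst))
  obtain ⟨c, hc⟩ := KC_le_of_sigmaOne hU hB.exists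
  refine ⟨c, fun N x y z hxN hyN => ?_⟩
  obtain ⟨p, hp, hpx⟩ := exists_program hU x z
  obtain ⟨q, hq, hqy⟩ := exists_program hU y x
  obtain ⟨G, hG, hGcard⟩ := exists_finset_image
    ((allStr (KC U x z)).toFinset ×ˢ (allStr (KC U y x)).toFinset)
    (fun (s : Str × Str) (w : Str) => ∃ x' y' : Str, x' ∈ U.1 (s.1, z) ∧ y' ∈ U.1 (s.2, x') ∧
      w = g (x', y')) (by
      rintro s _ _ ⟨x', y', hx', hy', rfl⟩ ⟨x'', y'', hx'', hy'', rfl⟩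
      obtain rfl := Part.mem_unique hx' hx''
      rw [Part.mem_unique hy' hy''])
  refine hc N _ _ 0 0 hxN hyN (Nat.zero_le _) (Nat.zero_le _) z _ _ G ?_ ?_
    ⟨((p, q), (x, y)), ⟨hp, hq⟩, hpx, hqy, rfl⟩
  · rintro w ⟨⟨⟨p', q'⟩, x', y'⟩, ⟨hp', hq'⟩, hx', hy', hw⟩
    refine hG (p', q') ?_ w ⟨x', y', hx', hy', hw⟩
    simpa [mem_allStr] using ⟨hp', hq'⟩
  · rwa [Finset.card_product, card_allStr_toFinset, card_allStr_toFinset, ← pow_add] at hGcard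

variable {pair : Str → Str → Str}

/-- Prefixes of strings simple given `a` and `b` are simple given the pair of `a` and `b`. -/
theorem KC_pair_take_le (hU : OptimalMachine U)
    (hpair_comp : Computable fun p : Str × Str => pair p.1 p.2)
    (hpair_inj : Function.Injective fun p : Str × Str => pair p.1 p.2) :
    ∃ c : ℕ, ∀ (N l m : ℕ) (a b a' b' : Str), KC U a' a ≤ N → KC U b' b ≤ N → l ≤ N → m ≤ N →
      KC U (pair (a'.take l) (b'.take m)) (pair a b) ≤ KC U a' a + KC U b' b + c * log2 N := by
  let V := (((ℕ × ℕ × ℕ × ℕ) × Str) × Str) × ((Str × Str) × (Str × Str) × (Str × Str))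
  let B : (((ℕ × ℕ × ℕ × ℕ) × Str) × Str) × ((Str × Str) × (Str × Str) × (Str × Str)) → Prop :=
    fun v => (v.2.1.1.length = v.1.1.1.1 ∧ v.2.1.2.length = v.1.1.1.2.1) ∧
      v.2.2.2.1 ∈ U.1 (v.2.1.1, v.2.2.1.1) ∧ v.2.2.2.2 ∈ U.1 (v.2.1.2, v.2.2.1.2) ∧
      v.1.1.2 = pair v.2.2.1.1 v.2.2.1.2 ∧
      v.1.2 = pair (v.2.2.2.1.take v.1.1.1.2.2.1) (v.2.2.2.2.take v.1.1.1.2.2.2)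
  have hB : SigmaOne B := by
    have he : Primrec fun v : V => v.1.1.1 := Primrec.fst.comp (Primrec.fst.comp Primrec.fst)
    have hp : Primrec fun v : V => v.2.1 := Primrec.fst.comp Primrec.snd
    have hx : Primrec fun v : V => v.2.2.1 := Primrec.fst.comp (Primrec.snd.comp Primrec.snd)
    have hy : Primrec fun v : V => v.2.2.2 := Primrec.snd.comp (Primrec.snd.comp Primrec.snd)
    have he' : Primrec fun v : V => v.1.1.1.2.2 := Primrec.snd.comp (Primrec.snd.comp he)
    refine SigmaOne.and (SigmaOne.and ?_ ?_) (SigmaOne.and ?_ (SigmaOne.and ?_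
      (SigmaOne.and ?_ ?_)))
    · exact SigmaOne.length_eq (Primrec.fst.comp hp) (Primrec.fst.comp he)
    · exact SigmaOne.length_eq (Primrec.snd.comp hp) (Primrec.fst.comp (Primrec.snd.comp he))
    · exact U.sigmaOne (Primrec.fst.comp hp) (Primrec.fst.comp hx) (Primrec.fst.comp hy)
    · exact U.sigmaOne (Primrec.snd.comp hp) (Primrec.snd.comp hx) (Primrec.snd.comp hy)
    · exact hpair_comp.sigmaOne.comp (f := fun v : V => (v.2.2.1, v.1.1.2))
        (Primrec.pair hx (Primrec.snd.comp (Primrec.fst.comp Primrec.fst)))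
    · exact hpair_comp.sigmaOne.comp (f := fun v : V =>
        ((v.2.2.2.1.take v.1.1.1.2.2.1, v.2.2.2.2.take v.1.1.1.2.2.2), v.1.2))
        (Primrec.pair (Primrec.pair
          (Primrec.list_take.comp (Primrec.fst.comp he') (Primrec.fst.comp hy))
          (Primrec.list_take.comp (Primrec.snd.comp he') (Primrec.snd.comp hy)))
          (Primrec.snd.comp Primrec.fst))
  obtain ⟨c, hc⟩ := KC_le_of_sigmaOne hU hB.exists
  refine ⟨c, fun N l m a b a' b' ha hb hl hm => ?_⟩
  obtain ⟨p, hp, hpa⟩ := exists_program hU a' a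
  obtain ⟨q, hq, hqb⟩ := exists_program hU b' b
  obtain ⟨G, hG, hGcard⟩ := exists_finset_image
    ((allStr (KC U a' a)).toFinset ×ˢ (allStr (KC U b' b)).toFinset)
    (fun (s : Str × Str) (w : Str) => ∃ x y : Str, x ∈ U.1 (s.1, a) ∧ y ∈ U.1 (s.2, b) ∧
      w = pair (x.take l) (y.take m)) (by
      rintro s _ _ ⟨x', y', hx', hy', rfl⟩ ⟨x'', y'', hx'', hy'', rfl⟩
      rw [Part.mem_unique hx' hx'', Part.mem_unique hy' hy''])
  refine hc N _ _ l m ha hb hl hm (pair a b) _ _ G ?_ ?_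
    ⟨((p, q), (a, b), (a', b')), ⟨hp, hq⟩, hpa, hqb, rfl, rfl⟩
  · rintro w ⟨⟨⟨p', q'⟩, ⟨x', y'⟩, x, y⟩, ⟨hp', hq'⟩, hx, hy, hab, hw⟩
    obtain ⟨rfl, rfl⟩ := Prod.mk.inj (@hpair_inj (a, b) (x', y') hab)
    refine hG (p', q') ?_ w ⟨x, y, hx, hy, hw⟩
    simpa [mem_allStr] using ⟨hp', hq'⟩
  · rwa [Finset.card_product, card_allStr_toFinset, card_allStr_toFinset, ← pow_add] at hGcard

/-- The hard direction of symmetry of information. -/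
theorem KC_add_KC_le_KC_pair (hU : OptimalMachine U)
    (hpair_comp : Computable fun p : Str × Str => pair p.1 p.2)
    (hpair_inj : Function.Injective fun p : Str × Str => pair p.1 p.2) :
    ∃ c : ℕ, ∀ (N : ℕ) (x y : Str), KC U (pair x y) [] ≤ N →
      KC U x [] + KC U y x ≤ KC U (pair x y) [] + c * log2 N := by
  classical
  let E : Str × (ℕ × Str) → Prop := fun z => ∃ v : Str × Str,
    v.1.length = z.2.1 ∧ v.2 = pair z.2.2 z.1 ∧ v.2 ∈ U.1 (v.1, [])
  have hE : SigmaOne E := by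
    let V := (Str × (ℕ × Str)) × (Str × Str)
    refine SigmaOne.exists (p := fun w : V => w.2.1.length = w.1.2.1 ∧
      w.2.2 = pair w.1.2.2 w.1.1 ∧ w.2.2 ∈ U.1 (w.2.1, [])) ?_
    have hp : Primrec fun w : V => w.2.1 := Primrec.fst.comp Primrec.snd
    have hw : Primrec fun w : V => w.2.2 := Primrec.snd.comp Primrec.snd
    have hz : Primrec fun w : V => w.1.2 := Primrec.snd.comp Primrec.fst
    refine SigmaOne.and (SigmaOne.length_eq hp (Primrec.fst.comp hz)) (SigmaOne.and ?_ ?_)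
    · exact hpair_comp.sigmaOne.comp (f := fun w : V => ((w.1.2.2, w.1.1), w.2.2))
        (Primrec.pair (Primrec.pair (Primrec.snd.comp hz) (Primrec.fst.comp Primrec.fst)) hw)
    · exact U.sigmaOne hp (Primrec.const []) hw
  have hA₁ : SigmaOne fun z : ((ℕ × ℕ × ℕ × ℕ) × Str) × Str => E (z.2, (z.1.1.1, z.1.2)) :=
    hE.comp (Primrec.pair Primrec.snd (Primrec.pair
      (Primrec.fst.comp (Primrec.fst.comp Primrec.fst)) (Primrec.snd.comp Primrec.fst)))
  have hA₂ : SigmaOne fun z : ((ℕ × ℕ × ℕ × ℕ) × Str) × Str =>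
      ∃ L : List Str, L.length = 2 ^ z.1.1.2.1 ∧ L.Nodup ∧ ∀ y ∈ L, E (y, (z.1.1.1, z.2)) :=
    hE.many.comp (f := fun z : ((ℕ × ℕ × ℕ × ℕ) × Str) × Str =>
      (2 ^ z.1.1.2.1, (z.1.1.1, z.2))) (Primrec.pair
        (primrec_two_pow.comp (Primrec.fst.comp (Primrec.snd.comp
          (Primrec.fst.comp Primrec.fst))))
        (Primrec.pair (Primrec.fst.comp (Primrec.fst.comp Primrec.fst)) Primrec.snd))
  obtain ⟨c₁, hc₁⟩ := KC_le_of_sigmaOne hU hA₁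
  obtain ⟨c₂, hc₂⟩ := KC_le_of_sigmaOne hU hA₂
  refine ⟨c₁ + c₂ + 1, fun N x y hN => ?_⟩
  generalize hγ : KC U (pair x y) [] = γ at *
  obtain ⟨p, hp, hpw⟩ := exists_program hU (pair x y) []
  have hExy : E (y, (γ, x)) := ⟨(p, pair x y), hp.trans hγ, rfl, hpw⟩
  obtain ⟨P, hP, hPcard⟩ := exists_finset_image (allStr γ).toFinset
    (fun (p : Str) (w : Str × Str) => pair w.1 w.2 ∈ U.1 (p, []))
    (fun p w w' h h' => hpair_inj (Part.mem_unique h h'))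
  rw [card_allStr_toFinset] at hPcard
  have hEP : ∀ x y, E (y, (γ, x)) → (x, y) ∈ P := by
    rintro x y ⟨⟨p, w⟩, hp, hw, hpw⟩
    refine hP p (List.mem_toFinset.2 (mem_allStr.2 hp)) (x, y) ?_
    simp only at hw hpw
    rwa [← hw]
  let A : Str → Finset Str := fun x => (P.filter fun w => w.1 = x).image Prod.snd
  have hA : ∀ x y, E (y, (γ, x)) → y ∈ A x := fun x y h =>
    Finset.mem_image.2 ⟨(x, y), Finset.mem_filter.2 ⟨hEP x y h, rfl⟩, rfl⟩
  let B : Finset Str := (A x).filter fun y => E (y, (γ, x))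
  have hB : ∀ y, y ∈ B ↔ E (y, (γ, x)) := fun y =>
    ⟨fun h => (Finset.mem_filter.1 h).2, fun h => Finset.mem_filter.2 ⟨hA x y h, h⟩⟩
  have hBne : B.card ≠ 0 := Finset.card_ne_zero_of_mem ((hB y).2 hExy)
  obtain ⟨s, hs₁, hs₂⟩ : ∃ s, 2 ^ s ≤ B.card ∧ B.card < 2 ^ (s + 1) :=
    ⟨Nat.log 2 B.card, Nat.pow_log_le_self 2 hBne, Nat.lt_pow_succ_log_self (by norm_num) _⟩
  have hAcard : ∀ x, (A x).card ≤ (P.filter fun w => w.1 = x).card := fun x =>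
    Finset.card_image_le
  have hsγ : s ≤ γ := by
    refine (Nat.pow_le_pow_iff_right (a := 2) (by norm_num)).1 (hs₁.trans ?_)
    exact (Finset.card_filter_le _ _).trans ((hAcard x).trans
      ((Finset.card_filter_le _ _).trans hPcard))
  let X : Finset Str := (P.image Prod.fst).filter fun x => 2 ^ s ≤ (A x).card
  have hXcard : X.card ≤ 2 ^ (γ - s) := by
    refine Nat.le_of_mul_le_mul_right (c := 2 ^ s) ?_ (by positivity)
    calc X.card * 2 ^ s ≤ ∑ x ∈ X, (P.filter fun w => w.1 = x).card := by
          rw [← smul_eq_mul]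
          exact Finset.card_nsmul_le_sum _ _ _ fun x hx =>
            (Finset.mem_filter.1 hx).2.trans (hAcard x)
      _ ≤ ∑ x ∈ P.image Prod.fst, (P.filter fun w => w.1 = x).card :=
          Finset.sum_le_sum_of_subset (Finset.filter_subset _ _)
      _ = P.card := (Finset.card_eq_sum_card_image Prod.fst P).symm
      _ ≤ 2 ^ γ := hPcard
      _ = 2 ^ (γ - s) * 2 ^ s := by rw [← pow_add, Nat.sub_add_cancel hsγ]
  have hy := hc₁ N γ 0 0 0 hN (Nat.zero_le _) (Nat.zero_le _) (Nat.zero_le _) x y (s + 1) B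
    (fun y' h => (hB y').2 h) hs₂.le hExy
  have hx := hc₂ N γ s 0 0 hN (hsγ.trans hN) (Nat.zero_le _) (Nat.zero_le _) [] x (γ - s) X
    (by
      rintro x' ⟨L, hL, hnd, hLE⟩
      have hle : 2 ^ s ≤ (A x').card := by
        rw [← hL, ← List.toFinset_card_of_nodup hnd]
        exact Finset.card_le_card fun y' hy' => hA x' y' (hLE y' (List.mem_toFinset.1 hy'))
      refine Finset.mem_filter.2 ⟨?_, hle⟩
      have hpos : 0 < (A x').card := lt_of_lt_of_le (by positivity) hle
      obtain ⟨y', hy'⟩ := Finset.card_pos.1 hpos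
      obtain ⟨w, hw, -⟩ := Finset.mem_image.1 hy'
      obtain ⟨hwP, hwx⟩ := Finset.mem_filter.1 hw
      exact Finset.mem_image.2 ⟨w, hwP, hwx⟩) hXcard (by
      obtain ⟨L, hL, hLcard⟩ := Finset.exists_subset_card_eq hs₁
      exact ⟨L.toList, by rw [Finset.length_toList, hLcard], L.nodup_toList,
        fun y' hy' => (hB y').1 (hL (Finset.mem_toList.1 hy'))⟩)
  have := one_le_log2 N
  have : (c₁ + c₂ + 1) * log2 N = c₁ * log2 N + c₂ * log2 N + log2 N := by ring
  omega

end Complexity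

theorem hashDeg_le_two_pow (N : ℕ) : hashDeg N ≤ 2 ^ (3 * log2 N + 5) := by
  have h : (N + 2) ^ 3 ≤ (2 ^ (log2 N + 1)) ^ 3 := Nat.pow_le_pow_left (lt_two_pow_log2 N).le 3
  calc hashDeg N ≤ 4 * (2 ^ (log2 N + 1)) ^ 3 := Nat.mul_le_mul_left 4 h
    _ = 2 ^ (3 * log2 N + 5) := by ring

theorem log2_hashDeg_le (N : ℕ) : log2 (hashDeg N) ≤ 9 * log2 N := by
  have h₁ : hashDeg N + 2 ≤ 2 ^ (3 * log2 N + 6) := by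
    have := hashDeg_le_two_pow N
    have h2 : 2 ≤ 2 ^ (3 * log2 N + 5) := Nat.le_self_pow (by omega) 2
    rw [pow_succ]
    omega
  have h₂ : log2 (hashDeg N) ≤ 3 * log2 N + 6 :=
    (Nat.log_mono_right h₁).trans_eq (Nat.log_pow (by norm_num) _)
  have := one_le_log2 N
  omega

theorem le_hashDeg (N : ℕ) : N ≤ hashDeg N :=
  calc N ≤ N + 2 := by omega
    _ ≤ (N + 2) ^ 3 := Nat.le_self_pow (by norm_num) _
    _ ≤ hashDeg N := Nat.le_mul_of_pos_left _ (by norm_num)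

theorem card_shorter_le (u : ℕ) :
    ∃ Q : Finset Str, (∀ p : Str, p.length < u → p ∈ Q) ∧ Q.card ≤ 2 ^ u := by
  classical
  refine ⟨(Finset.range u).biUnion fun j => (allStr j).toFinset, fun p hp => ?_, ?_⟩
  · simpa [mem_allStr] using hp
  · refine Finset.card_biUnion_le.trans ?_
    simp only [card_allStr_toFinset]
    exact (Nat.geomSum_lt (m := 2) le_rfl (by simp)).le

section Complexity

variable {U : CondMachine} {Q : (ℕ × ℕ) × List (List Str) → Prop}

/-- The hash values of a suitable shortest program of `a` are simple given `a`. -/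
theorem exists_program_KC_hashApp_le (hU : OptimalMachine U) (hQ : SigmaOne Q)
    (hQ_unique : ∀ a F F', Q (a, F) → Q (a, F') → F = F') :
    ∃ c : ℕ, ∀ (N : ℕ) (a : Str) (F : List (List Str)), KC U a [] ≤ N →
      Q ((N, KC U a []), F) → ∃ x : Str, x.length = KC U a [] ∧ a ∈ U.1 (x, []) ∧
        ∀ i < hashDeg N, KC U (hashApp F x i) a ≤ c * log2 N := by
  have hP : SigmaOne fun z : (ℕ × Str) × Str => z.2.length = z.1.1 ∧ z.1.2 ∈ U.1 (z.2, []) :=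
    SigmaOne.and (SigmaOne.length_eq Primrec.snd (Primrec.fst.comp Primrec.fst))
      (U.sigmaOne Primrec.snd (Primrec.const []) (Primrec.snd.comp Primrec.fst))
  obtain ⟨P, hP, hP_prog, hP_unique, hP_exists⟩ := hP.uniformize
  let V := (((ℕ × ℕ × ℕ × ℕ) × Str) × Str) × (Str × List (List Str))
  let B : V → Prop := fun v => P ((v.1.1.1.2.1, v.1.1.2), v.2.1) ∧
    Q ((v.1.1.1.1, v.1.1.1.2.1), v.2.2) ∧ v.1.2 = hashApp v.2.2 v.2.1 v.1.1.1.2.2.1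
  have hB : SigmaOne B := by
    have he : Primrec fun v : V => v.1.1.1 := Primrec.fst.comp (Primrec.fst.comp Primrec.fst)
    have hk : Primrec fun v : V => v.1.1.1.2.1 := Primrec.fst.comp (Primrec.snd.comp he)
    have hi : Primrec fun v : V => v.1.1.1.2.2.1 :=
      Primrec.fst.comp (Primrec.snd.comp (Primrec.snd.comp he))
    have hx : Primrec fun v : V => v.2.1 := Primrec.fst.comp Primrec.snd
    have hF : Primrec fun v : V => v.2.2 := Primrec.snd.comp Primrec.snd
    have happ : Primrec fun v : V => hashApp v.2.2 v.2.1 v.1.1.1.2.2.1 :=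
      primrec_hashApp.comp (g := fun v : V => (v.2.2, v.2.1, v.1.1.1.2.2.1))
        (Primrec.pair hF (Primrec.pair hx hi))
    refine SigmaOne.and ?_ (SigmaOne.and ?_ (PrimrecPred.sigmaOne ?_))
    · exact hP.comp (f := fun v : V => ((v.1.1.1.2.1, v.1.1.2), v.2.1))
        (Primrec.pair (Primrec.pair hk (Primrec.snd.comp (Primrec.fst.comp Primrec.fst))) hx)
    · exact hQ.comp (f := fun v : V => ((v.1.1.1.1, v.1.1.1.2.1), v.2.2))
        (Primrec.pair (Primrec.pair (Primrec.fst.comp he) hk) hF)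
    · exact Primrec.eq.comp (Primrec.snd.comp Primrec.fst) happ
  obtain ⟨c, hc⟩ := KC_le_of_sigmaOne hU hB.exists
  refine ⟨9 * c, fun N a F ha hF => ?_⟩
  obtain ⟨x₀, hx₀, hx₀a⟩ := exists_program hU a []
  obtain ⟨x, hx⟩ := hP_exists (KC U a [], a) x₀ ⟨hx₀, hx₀a⟩
  obtain ⟨hxk, hxa⟩ := hP_prog _ hx
  refine ⟨x, hxk, hxa, fun i hi => ?_⟩
  have h := hc (hashDeg N) N (KC U a []) i 0 (le_hashDeg N) (ha.trans (le_hashDeg N)) hi.le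
    (Nat.zero_le _) a (hashApp F x i) 0 {hashApp F x i} (by
      rintro w ⟨⟨x', F'⟩, hx', hF', hw⟩
      obtain rfl := hP_unique _ _ _ hx hx'
      obtain rfl := hQ_unique _ _ _ hF hF'
      exact Finset.mem_singleton.2 hw) (by simp) ⟨(x, F), hx, hF, rfl⟩
  have := Nat.mul_le_mul_left c (log2_hashDeg_le N)
  linarith

/-- If many hash values of a program of `a` have an `l`-bit prefix of complexity less than `u`
given `y`, then the complexity of `a` given `y` is at most about `u`. -/
theorem KC_le_of_many_hash_simple (hU : OptimalMachine U) (hQ : SigmaOne Q)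
    (hQ_good : ∀ z, Q z → GoodHash z.1.1 z.1.2 z.2)
    (hQ_unique : ∀ a F F', Q (a, F) → Q (a, F') → F = F') :
    ∃ c : ℕ, ∀ (N k l u : ℕ) (a x y : Str) (F : List (List Str)), k ≤ N → l ≤ k →
      u + 3 * log2 N + 6 ≤ l → Q ((N, k), F) → x.length = k → a ∈ U.1 (x, []) →
      4 * N + 1 ≤ ((Finset.range (hashDeg N)).filter fun i =>
        KC U ((hashApp F x i).take l) y < u).card →
      KC U a y ≤ u + c * log2 N := by
  classical
  let W := (((ℕ × ℕ × ℕ × ℕ) × Str) × Str) × (Str × List (List Str))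
  let D : ℕ × W → Prop := fun z => z.1 < hashDeg z.2.1.1.1.1 ∧
    ∃ p : Str, p.length < z.2.1.1.1.2.2.2 ∧
      (hashApp z.2.2.2 z.2.2.1 z.1).take z.2.1.1.1.2.2.1 ∈ U.1 (p, z.2.1.1.2)
  have hD : SigmaOne D := by
    have he : Primrec fun z : ℕ × W => z.2.1.1.1 :=
      Primrec.fst.comp (Primrec.fst.comp (Primrec.fst.comp Primrec.snd))
    refine SigmaOne.and (PrimrecPred.sigmaOne ?_) (SigmaOne.exists (p := fun v : (ℕ × W) × Str =>
      v.2.length < v.1.2.1.1.1.2.2.2 ∧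
      (hashApp v.1.2.2.2 v.1.2.2.1 v.1.1).take v.1.2.1.1.1.2.2.1 ∈ U.1 (v.2, v.1.2.1.1.2))
      (SigmaOne.and (PrimrecPred.sigmaOne ?_) ?_))
    · exact Primrec.nat_lt.comp Primrec.fst (primrec_hashDeg.comp (Primrec.fst.comp he))
    · exact Primrec.nat_lt.comp (Primrec.list_length.comp Primrec.snd)
        (Primrec.snd.comp (Primrec.snd.comp (Primrec.snd.comp (he.comp Primrec.fst))))
    · have hxF : Primrec fun v : (ℕ × W) × Str => v.1.2.2 :=
        Primrec.snd.comp (Primrec.snd.comp Primrec.fst)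
      have happ : Primrec fun v : (ℕ × W) × Str => hashApp v.1.2.2.2 v.1.2.2.1 v.1.1 :=
        primrec_hashApp.comp (g := fun v : (ℕ × W) × Str => (v.1.2.2.2, v.1.2.2.1, v.1.1))
          (Primrec.pair (Primrec.snd.comp hxF) (Primrec.pair (Primrec.fst.comp hxF)
            (Primrec.fst.comp Primrec.fst)))
      refine U.sigmaOne Primrec.snd ?_ (Primrec.list_take.comp ?_ happ)
      · exact Primrec.snd.comp (Primrec.fst.comp (Primrec.fst.comp
          (Primrec.snd.comp Primrec.fst)))
      · exact Primrec.fst.comp (Primrec.snd.comp (Primrec.snd.comp (he.comp Primrec.fst)))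
  let B : W → Prop := fun v => v.2.1.length = v.1.1.1.2.1 ∧ v.1.2 ∈ U.1 (v.2.1, []) ∧
    Q ((v.1.1.1.1, v.1.1.1.2.1), v.2.2) ∧
    ∃ L : List ℕ, L.length = 4 * v.1.1.1.1 + 1 ∧ L.Nodup ∧ ∀ i ∈ L, D (i, v)
  have hB : SigmaOne B := by
    have he : Primrec fun v : W => v.1.1.1 := Primrec.fst.comp (Primrec.fst.comp Primrec.fst)
    have hk : Primrec fun v : W => v.1.1.1.2.1 := Primrec.fst.comp (Primrec.snd.comp he)
    have hx : Primrec fun v : W => v.2.1 := Primrec.fst.comp Primrec.snd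
    refine SigmaOne.and (SigmaOne.length_eq hx hk) (SigmaOne.and
      (U.sigmaOne hx (Primrec.const []) (Primrec.snd.comp Primrec.fst)) (SigmaOne.and ?_ ?_))
    · exact hQ.comp (f := fun v : W => ((v.1.1.1.1, v.1.1.1.2.1), v.2.2))
        (Primrec.pair (Primrec.pair (Primrec.fst.comp he) hk) (Primrec.snd.comp Primrec.snd))
    · exact hD.many.comp (f := fun v : W => (4 * v.1.1.1.1 + 1, v)) (Primrec.pair
        (Primrec.succ.comp (Primrec.nat_mul.comp (Primrec.const 4) (Primrec.fst.comp he)))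
        Primrec.id)
  obtain ⟨c, hc⟩ := KC_le_of_sigmaOne hU hB.exists
  refine ⟨c, fun N k l u a x y F hk hl hu hF hxk hxa hmany => ?_⟩
  obtain ⟨Z, hZ, hZcard⟩ := card_shorter_le u
  obtain ⟨S₀, hS₀, hS₀card⟩ := exists_finset_image Z (fun p w => w ∈ U.1 (p, y))
    (fun p w w' => Part.mem_unique)
  let S := S₀.filter fun w => w.length = l
  have hScard : S.card ≤ 2 ^ u := (Finset.card_filter_le _ _).trans (hS₀card.trans hZcard)
  let T := (allStr k).toFinset.filter fun x => 4 * N + 1 ≤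
    ((Finset.range (hashDeg N)).filter fun i => (hashApp F x i).take l ∈ S).card
  have hgood := hQ_good _ hF
  have hTcard : T.card ≤ 2 ^ u := by
    refine (hgood.card_le hl S T (fun w hw => (Finset.mem_filter.1 hw).2) ?_
      (fun x hx => mem_allStr.1 (List.mem_toFinset.1 (Finset.mem_filter.1 hx).1))
      (fun x hx => (Finset.mem_filter.1 hx).2)).trans hScard
    calc S.card * (2 * hashDeg N) ≤ 2 ^ u * (2 * 2 ^ (3 * log2 N + 5)) :=
          Nat.mul_le_mul hScard (Nat.mul_le_mul_left 2 (hashDeg_le_two_pow N))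
      _ = 2 ^ (u + 3 * log2 N + 6) := by ring
      _ ≤ 2 ^ l := Nat.pow_le_pow_right (by norm_num) hu
  obtain ⟨G, hG, hGcard⟩ := exists_finset_image T (fun x a => a ∈ U.1 (x, []))
    (fun x a a' => Part.mem_unique)
  refine hc N N k l u le_rfl hk (hl.trans hk) (by omega) y a u G ?_ (hGcard.trans hTcard) ?_
  · rintro a' ⟨⟨x', F'⟩, hx'k, hx'a, hF', L, hL, hnd, hLD⟩
    simp only at hx'k hx'a hF' hL
    obtain rfl := hQ_unique _ _ _ hF hF'
    have hx' : x' ∈ allStr k := mem_allStr.2 hx'k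
    refine hG x' (Finset.mem_filter.2 ⟨List.mem_toFinset.2 hx', ?_⟩) a' hx'a
    rw [← hL, ← List.toFinset_card_of_nodup hnd]
    refine Finset.card_le_card fun i hi => ?_
    obtain ⟨hi, p, hp, hpw⟩ := hLD i (List.mem_toFinset.1 hi)
    refine Finset.mem_filter.2 ⟨Finset.mem_range.2 hi, Finset.mem_filter.2
      ⟨hS₀ p (hZ p hp) _ hpw, ?_⟩⟩
    rw [List.length_take, hgood.1 x' hx' i (List.mem_range.2 hi)]
    exact min_eq_left hl
  · obtain ⟨L, hL, hLcard⟩ := Finset.exists_subset_card_eq hmany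
    refine ⟨(x, F), hxk, hxa, hF, L.toList, by rw [Finset.length_toList, hLcard],
      L.nodup_toList, fun i hi => ?_⟩
    obtain ⟨hi, hKC⟩ := Finset.mem_filter.1 (hL (Finset.mem_toList.1 hi))
    obtain ⟨p, hp, hpw⟩ := exists_program hU ((hashApp F x i).take l) y
    exact ⟨Finset.mem_range.1 hi, p, hp.trans_lt hKC, hpw⟩

/-- Each string `a` has a fingerprint of length `C(a)`, simple given `a`, whose prefixes are as
complex as possible relative to any prescribed short list of conditions. -/
theorem exists_fingerprint (hU : OptimalMachine U) :
    ∃ c : ℕ, ∀ (N : ℕ) (a : Str) (Y : Finset Str), KC U a [] ≤ N → Y.card ≤ N + 2 →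
      ∃ a' : Str, a'.length = KC U a [] ∧ KC U a' a ≤ c * log2 N ∧
        ∀ y ∈ Y, ∀ l ≤ KC U a [], min l (KC U a y) ≤ KC U (a'.take l) y + c * log2 N := by
  classical
  obtain ⟨Q, hQ, hQ_good, hQ_unique, hQ_exists⟩ := primrec_goodHash.sigmaOne.uniformize
  obtain ⟨c₁, hc₁⟩ := exists_program_KC_hashApp_le hU hQ hQ_unique
  obtain ⟨c₂, hc₂⟩ := KC_le_of_many_hash_simple hU hQ hQ_good hQ_unique
  refine ⟨c₁ + c₂ + 9, fun N a Y ha hY => ?_⟩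
  set k := KC U a [] with hk
  set c := c₁ + c₂ + 9 with hc
  have hlog := one_le_log2 N
  have hcl : c * log2 N = c₁ * log2 N + c₂ * log2 N + 9 * log2 N := by rw [hc]; ring
  obtain ⟨F₀, hF₀⟩ := exists_goodHash ha
  obtain ⟨F, hF⟩ := hQ_exists (N, k) F₀ hF₀
  obtain ⟨x, hxk, hxa, hx⟩ := hc₁ N a F ha hF
  by_contra hcon
  push Not at hcon
  have hbad : ∀ i ∈ Finset.range (hashDeg N), ∃ z ∈ Y ×ˢ Finset.range (k + 1),
      KC U ((hashApp F x i).take z.2) z.1 + c * log2 N < min z.2 (KC U a z.1) := by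
    intro i hi
    rw [Finset.mem_range] at hi
    obtain ⟨y, hy, l, hl, h⟩ := hcon (hashApp F x i)
      ((hQ_good _ hF).1 x (mem_allStr.2 hxk) i (List.mem_range.2 hi))
      ((hx i hi).trans (by omega))
    exact ⟨(y, l), Finset.mem_product.2 ⟨hy, Finset.mem_range.2 (by omega)⟩, h⟩
  choose! f hf hfbad using hbad
  obtain ⟨⟨y, l⟩, hyl, hcard⟩ := Finset.exists_lt_card_fiber_of_mul_lt_card_of_maps_to
    (n := 4 * N) hf (by
      rw [Finset.card_product, Finset.card_range, Finset.card_range, hashDeg]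
      calc Y.card * (k + 1) * (4 * N) ≤ (N + 2) * (N + 2) * (4 * N) := by gcongr; omega
        _ < 4 * (N + 2) ^ 3 := by nlinarith)
  have hlk : l ≤ k := by
    have := Finset.mem_range.1 (Finset.mem_product.1 hyl).2
    simp only at this
    omega
  have hsub : ∀ i ∈ (Finset.range (hashDeg N)).filter (fun i => f i = (y, l)),
      KC U ((hashApp F x i).take l) y + c * log2 N < min l (KC U a y) := by
    intro i hi
    obtain ⟨hi, hfi⟩ := Finset.mem_filter.1 hi
    simpa only [hfi] using hfbad i hi
  obtain ⟨i, hi⟩ := Finset.card_pos.1 ((Nat.zero_le _).trans_lt hcard)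
  have hpos := hsub i hi
  have hml := min_le_left l (KC U a y)
  have hmK := min_le_right l (KC U a y)
  have := hc₂ N k l (min l (KC U a y) - c * log2 N) a x y F ha hlk (by omega) hF hxk hxa
    (hcard.trans_le (Finset.card_le_card fun i hi => Finset.mem_filter.2
      ⟨(Finset.mem_filter.1 hi).1, by have := hsub i hi; omega⟩))
  omega

end Complexity

theorem log2_le (n : ℕ) : log2 n ≤ n + 2 := Nat.log_le_self 2 _

theorem log2_mul_le (K n : ℕ) : log2 (K * (n + 2)) ≤ (K + 4) * log2 n := by
  have h₁ : K * (n + 2) + 2 ≤ 2 ^ (K + 3 + log2 n) :=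
    calc K * (n + 2) + 2 ≤ (K + 2) * (n + 2) := by nlinarith
      _ ≤ 2 ^ (K + 2) * 2 ^ (log2 n + 1) :=
          Nat.mul_le_mul (Nat.lt_two_pow_self).le (lt_two_pow_log2 n).le
      _ = 2 ^ (K + 3 + log2 n) := by ring
  have h₂ : log2 (K * (n + 2)) ≤ K + 3 + log2 n :=
    (Nat.log_mono_right h₁).trans_eq (Nat.log_pow (by norm_num) _)
  have := one_le_log2 n
  nlinarith

/-- Lemma 1: for all strings `a, b` (with `n = C(a) + C(b)`) there exist strings
`a', b'` of lengths `C(a), C(b)`, of complexity at least `C(a) - O(log n)` and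
`C(b) - O(log n)`, simple given `a` and `b` respectively, such that the mutual
information of any nonempty prefixes `a'_l, b'_m` is
`max(0, l + m - C(a,b)) + O(log n)`. -/
theorem muchnik_prefixes (U : CondMachine) (hU : OptimalMachine U)
    (pair : Str → Str → Str)
    (hpair_comp : Computable fun p : Str × Str => pair p.1 p.2)
    (hpair_inj : Function.Injective fun p : Str × Str => pair p.1 p.2) :
    ∃ c : ℕ, ∀ a b : Str, ∃ a' b' : Str,
      a'.length = KC U a [] ∧ b'.length = KC U b [] ∧
      (KC U a [] : ℤ) - (c : ℤ) * (log2 (KC U a [] + KC U b []) : ℤ) ≤ (KC U a' [] : ℤ) ∧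
      (KC U b [] : ℤ) - (c : ℤ) * (log2 (KC U a [] + KC U b []) : ℤ) ≤ (KC U b' [] : ℤ) ∧
      KC U a' a ≤ c * log2 (KC U a [] + KC U b []) ∧
      KC U b' b ≤ c * log2 (KC U a [] + KC U b []) ∧
      ∀ l m : ℕ, 1 ≤ l → l ≤ a'.length → 1 ≤ m → m ≤ b'.length →
        |((KC U (a'.take l) [] : ℤ) + (KC U (b'.take m) [] : ℤ)
            - (KC U (pair (a'.take l) (b'.take m)) [] : ℤ))
          - max 0 ((l : ℤ) + (m : ℤ) - (KC U (pair a b) [] : ℤ))|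
          ≤ (c : ℤ) * (log2 (KC U a [] + KC U b []) : ℤ) := by
  classical
  have hswap : Computable fun p : Str × Str => pair p.2 p.1 :=
    hpair_comp.comp (Computable.pair Computable.snd Computable.fst)
  obtain ⟨d₀, hd₀⟩ := KC_le_length hU
  obtain ⟨d₁, hd₁⟩ := KC_cond_le hU
  obtain ⟨cP, hcP⟩ := KC_comp_le hU hpair_comp
  obtain ⟨cS, hcS⟩ := KC_comp_le hU hswap
  obtain ⟨cT, hcT⟩ := KC_comp_le hU (g := Prod.snd) Computable.snd
  obtain ⟨cJ, hcJ⟩ := KC_pair_take_le hU hpair_comp hpair_inj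
  obtain ⟨cI, hcI⟩ := KC_add_KC_le_KC_pair hU hpair_comp hpair_inj
  obtain ⟨cH, hcH⟩ := exists_fingerprint hU
  let K₁ := 1 + d₀ + d₁ + cH
  let K₂ := 2 + cP + cS + cJ
  let C := 10 * (cP + cS + cT + cJ + cI + cH + d₀ + d₁)
  refine ⟨C * ((K₂ + 4) * (K₁ + 4)), fun a b => ?_⟩
  set α := KC U a [] with hα
  set β := KC U b [] with hβ
  set n := α + β with hn
  let N₁ := K₁ * (n + 2)
  let N₂ := K₂ * (N₁ + 2)
  obtain ⟨a', ha'len, ha'a, ha'⟩ := hcH n a {[], b} (by omega)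
    ((Finset.card_le_two).trans (by omega))
  obtain ⟨b', hb'len, hb'b, hb'⟩ := hcH n b ((Finset.range (α + 1)).image fun l => a'.take l)
    (by omega) (Finset.card_image_le.trans (by rw [Finset.card_range]; omega))
  have hL : log2 N₂ ≤ (K₂ + 4) * (K₁ + 4) * log2 n :=
    calc log2 N₂ ≤ (K₂ + 4) * log2 N₁ := log2_mul_le _ _
      _ ≤ (K₂ + 4) * ((K₁ + 4) * log2 n) := Nat.mul_le_mul_left _ (log2_mul_le _ _)
      _ = _ := by ring
  have hN₁ : n + d₀ + d₁ + cH * log2 n ≤ N₁ := by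
    have h := Nat.mul_le_mul_left cH (log2_le n)
    have : N₁ = n + 2 + d₀ * (n + 2) + d₁ * (n + 2) + cH * (n + 2) := by simp only [N₁, K₁]; ring
    have h₀ : d₀ ≤ d₀ * (n + 2) := Nat.le_mul_of_pos_right _ (by omega)
    have h₁ : d₁ ≤ d₁ * (n + 2) := Nat.le_mul_of_pos_right _ (by omega)
    omega
  have hN₂ : 2 * N₁ + cP * log2 N₁ + cS * log2 N₁ + cJ * log2 N₁ ≤ N₂ := by
    have h := Nat.mul_le_mul_left (cP + cS + cJ) (log2_le N₁)
    have : N₂ = 2 * (N₁ + 2) + (cP + cS + cJ) * (N₁ + 2) := by simp only [N₂, K₂]; ring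
    have : (cP + cS + cJ) * log2 N₁ = cP * log2 N₁ + cS * log2 N₁ + cJ * log2 N₁ := by ring
    omega
  have hCL : C * log2 N₂ ≤ C * ((K₂ + 4) * (K₁ + 4)) * log2 n :=
    (Nat.mul_le_mul_left C hL).trans_eq (mul_assoc _ _ _).symm
  have hnN₁ : n ≤ N₁ := by omega
  have hN₁₂ : N₁ ≤ N₂ := by omega
  have hlog₁ : log2 N₁ ≤ log2 N₂ := log2_mono hN₁₂
  have hlogn : log2 n ≤ log2 N₂ := log2_mono (hnN₁.trans hN₁₂)
  have hlog : 1 ≤ log2 N₂ := one_le_log2 _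
  generalize hR : C * ((K₂ + 4) * (K₁ + 4)) * log2 n = R at *
  have hRint : ((C * ((K₂ + 4) * (K₁ + 4)) : ℕ) : ℤ) * (log2 n : ℤ) = (R : ℤ) := by
    rw [← hR]; push_cast; ring
  have hC : C * log2 N₂ = 10 * (cP * log2 N₂ + cS * log2 N₂ + cT * log2 N₂ + cJ * log2 N₂
      + cI * log2 N₂ + cH * log2 N₂ + d₀ * log2 N₂ + d₁ * log2 N₂) := by simp only [C]; ring
  have hcHn : cH * log2 n ≤ cH * log2 N₂ := Nat.mul_le_mul_left _ hlogn
  have hcP₁ : cP * log2 N₁ ≤ cP * log2 N₂ := Nat.mul_le_mul_left _ hlog₁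
  have hcS₁ : cS * log2 N₁ ≤ cS * log2 N₂ := Nat.mul_le_mul_left _ hlog₁
  have hcJ₁ : cJ * log2 N₁ ≤ cJ * log2 N₂ := Nat.mul_le_mul_left _ hlog₁
  have hd₀L : d₀ ≤ d₀ * log2 N₂ := Nat.le_mul_of_pos_right _ hlog
  have hd₁L : d₁ ≤ d₁ * log2 N₂ := Nat.le_mul_of_pos_right _ hlog
  have hnil : ([] : Str) ∈ (Finset.range (α + 1)).image fun l => a'.take l :=
    Finset.mem_image.2 ⟨0, Finset.mem_range.2 (by omega), rfl⟩
  have ha'take : a'.take α = a' := List.take_of_length_le ha'len.le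
  have hb'take : b'.take β = b' := List.take_of_length_le hb'len.le
  refine ⟨a', b', ha'len, hb'len, ?_, ?_, ?_, ?_, ?_⟩
  · have h := ha' [] (by simp) α le_rfl
    rw [ha'take, ← hα, min_self] at h
    rw [hRint]
    omega
  · have h := hb' [] hnil β le_rfl
    rw [hb'take, ← hβ, min_self] at h
    rw [hRint]
    omega
  · omega
  · omega
  intro l m _ hl _ hm
  rw [ha'len] at hl
  rw [hb'len] at hm
  rw [hRint]
  have hal : (a'.take l).length = l := by rw [List.length_take]; omega
  have hbm : (b'.take m).length = m := by rw [List.length_take]; omega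
  have hmem : a'.take l ∈ (Finset.range (α + 1)).image fun l => a'.take l :=
    Finset.mem_image.2 ⟨l, Finset.mem_range.2 (by omega), rfl⟩
  have ha_up := hd₀ (a'.take l) []
  have hb_up := hd₀ (b'.take m) []
  have hba_up := hd₀ (b'.take m) (a'.take l)
  rw [hal] at ha_up
  rw [hbm] at hb_up hba_up
  have ha_low := ha' [] (by simp) l hl
  have hab_low := ha' b (by simp) l hl
  have hb_low := hb' [] hnil m hm
  have hba_low := hb' _ hmem m hm
  rw [← hα, min_eq_left hl] at ha_low
  rw [← hβ, min_eq_left hm] at hb_low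
  have hab := hd₁ a b
  have hba := hd₁ b (a'.take l)
  have hpair_up := hcP N₁ (a'.take l) (b'.take m) [] (by omega) (by omega)
  have hγ_up := hcS N₁ b a [] (by omega) (by omega)
  have hpair_b_up := hcS N₁ (a'.take l) b [] (by omega) (by omega)
  simp only at hpair_up hγ_up hpair_b_up
  have hJ := hcJ N₁ l m a b a' b' (by omega) (by omega) (by omega) (by omega)
  have hT := hcT N₂ (pair a b) (pair (a'.take l) (b'.take m)) [] (by omega) (by omega)
  simp only at hT
  have hI := hcI N₂ (a'.take l) (b'.take m) (by omega)
  have hI_b := hcI N₂ b (a'.take l) (by omega)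
  rw [abs_le]
  constructor <;> omega
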